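/- arXiv:1804.07752 — 2 statements merged into one kernel-verified Lean document; each statement's English description precedes it below -/
import Mathlib

section
/- There is a universal constant C > 0 with the following property. Let (a,S) be a data pair with S flat with constants c₁, c₂ and ‖a‖ ≤ c₃, and m the solution of the associated Dyson equation. Then for every z ∈ ℍ the stability operator Id − C_{m(z)}S (where C_m[x] := m·x·m) is invertible on the Hilbert-space completion of (𝒜, ‖·‖₂) and ‖(Id − C_{m(z)}S)⁻¹‖₂ ≲ 1 + (ρ(z) + dist(z, supp ρ))^{−C}, uniformly for z ∈ ℍ, with the implicit constant depending only on c₁, c₂, c₃. -/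
open MeasureTheory

noncomputable section

namespace Dyson

/-- A tracial, faithful, normal state on the C⋆-algebra `A` (our model for a finite
von Neumann algebra together with its canonical tracial state). -/
structure TracialState (A : Type*) [CStarAlgebra A] [PartialOrder A] where
  tr : A →ₗ[ℂ] ℂ
  unital : tr 1 = 1
  tracial : ∀ x y : A, tr (x * y) = tr (y * x)
  state_pos : ∀ x : A, 0 ≤ x → 0 ≤ (tr x).re ∧ (tr x).im = 0
  faithful : ∀ x : A, 0 ≤ x → tr x = 0 → x = 0
  cont : Continuous tr

/-- A positive-operator-valued measure on `ℝ`, recorded through its values on sets of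
reals together with the family of scalar measures `B ↦ ⟨x, v(B) x⟩`. -/
structure OpMeasure (A : Type*) [CStarAlgebra A] [PartialOrder A]
    (φ : TracialState A) where
  val : Set ℝ → A
  nonneg : ∀ B : Set ℝ, 0 ≤ val B
  scalar : A → Measure ℝ
  scalarFin : ∀ x : A, IsFiniteMeasure (scalar x)
  compat : ∀ (x : A) (B : Set ℝ), MeasurableSet B →
    φ.tr (star x * val B * x) = Complex.ofReal ((scalar x) B).toReal

variable {A : Type*} [CStarAlgebra A] [PartialOrder A] [StarOrderedRing A]

/-- The real part `(x + x*)/2`. -/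
def reA (x : A) : A := (2 : ℂ)⁻¹ • (x + star x)

/-- The imaginary part `(x − x*)/(2i)`. -/
def imA (x : A) : A := (2 * Complex.I)⁻¹ • (x - star x)

/-- Strictly positive (positive definite) elements, i.e. `x ≥ ε·1` for some `ε > 0`. -/
def IsPosDef (x : A) : Prop := ∃ ε : ℝ, 0 < ε ∧ Complex.ofReal ε • (1 : A) ≤ x

/-- The scalar product `⟨x, y⟩ = τ(x* y)` induced by the state. -/
def inner2 (φ : TracialState A) (x y : A) : ℂ := φ.tr (star x * y)

/-- The `L²`-norm `‖x‖₂ = ⟨x*x⟩^{1/2}` induced by the state. -/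
def nrm2 (φ : TracialState A) (x : A) : ℝ := Real.sqrt (φ.tr (star x * x)).re

/-- The `L² → L²` operator norm of a map on `A`. -/
def opNorm2 (φ : TracialState A) (f : A → A) : ℝ :=
  sInf {C : ℝ | 0 ≤ C ∧ ∀ x : A, nrm2 φ (f x) ≤ C * nrm2 φ x}

/-- `S` preserves the cone of positive semidefinite elements. -/
def PosPreserving (S : A →L[ℂ] A) : Prop := ∀ x : A, 0 ≤ x → 0 ≤ S x

/-- `S` is symmetric with respect to `⟨x, y⟩ = τ(x* y)`. -/
def SymmOp (φ : TracialState A) (S : A →L[ℂ] A) : Prop :=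
  ∀ x y : A, φ.tr (star (S x) * y) = φ.tr (star x * S y)

/-- Flatness: `c₁⟨x⟩·1 ≤ S[x] ≤ c₂⟨x⟩·1` for all positive semidefinite `x`. -/
def IsFlat (φ : TracialState A) (S : A →L[ℂ] A) (c₁ c₂ : ℝ) : Prop :=
  ∀ x : A, 0 ≤ x →
    Complex.ofReal (c₁ * (φ.tr x).re) • (1 : A) ≤ S x ∧
      S x ≤ Complex.ofReal (c₂ * (φ.tr x).re) • (1 : A)

/-- `m` solves the Dyson equation `−m(z)⁻¹ = z·1 − a + S[m(z)]` on the upper half-plane,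
with positive definite imaginary part. -/
def IsDysonSolution (a : A) (S : A →L[ℂ] A) (m : ℂ → A) : Prop :=
  ∀ z : ℂ, 0 < z.im →
    IsPosDef (imA (m z)) ∧
    m z * (z • (1 : A) - a + S (m z)) = -1 ∧
    (z • (1 : A) - a + S (m z)) * m z = -1

/-- The support of an operator-valued measure. -/
def OpMeasure.supp {φ : TracialState A} (v : OpMeasure A φ) : Set ℝ :=
  {t : ℝ | ∀ ε : ℝ, 0 < ε → v.val (Set.Ioo (t - ε) (t + ε)) ≠ 0}

/-- The self-consistent density of states `ρ = ⟨v⟩ = ⟨1, v(·) 1⟩`. -/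
def OpMeasure.dos {φ : TracialState A} (v : OpMeasure A φ) : Measure ℝ :=
  v.scalar 1

/-- `m` is the Stieltjes transform of `v`. -/
def StieltjesRep (φ : TracialState A) (v : OpMeasure A φ) (m : ℂ → A) : Prop :=
  ∀ z : ℂ, 0 < z.im → ∀ x : A,
    φ.tr (star x * m z * x) = ∫ t : ℝ, ((t : ℂ) - z)⁻¹ ∂(v.scalar x)

/-- The support of a (positive) measure on `ℝ`. -/
def measSupp (μ : Measure ℝ) : Set ℝ :=
  {t : ℝ | ∀ ε : ℝ, 0 < ε → μ (Set.Ioo (t - ε) (t + ε)) ≠ 0}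

/-- The harmonic extension `ρ(z) = ⟨Im m(z)⟩/π` of the density of states. -/
def rhoH (φ : TracialState A) (m : ℂ → A) (z : ℂ) : ℝ :=
  (φ.tr (imA (m z))).re / Real.pi

end Dyson

set_option linter.unusedSectionVars false

open scoped InnerProductSpace

theorem LinearMap.IsSymmetric.norm_apply_le_of_pow {E : Type*} [SeminormedAddCommGroup E]
    [InnerProductSpace ℂ E] {T : E →ₗ[ℂ] E} (hT : T.IsSymmetric) {l : ℝ} (hl : 0 ≤ l) (x : E)
    (h : ∃ C : ℝ, ∀ n : ℕ, ‖(T ^ n) x‖ ≤ C * l ^ n) : ‖T x‖ ≤ l * ‖x‖ := by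
  obtain ⟨C, hC⟩ := h
  have hstep : ∀ n, ‖(T ^ (n + 1)) x‖ ^ 2 ≤ ‖(T ^ n) x‖ * ‖(T ^ (n + 2)) x‖ := by
    intro n
    have h1 : ⟪(T ^ (n + 1)) x, (T ^ (n + 1)) x⟫_ℂ = ⟪(T ^ n) x, (T ^ (n + 2)) x⟫_ℂ := by
      rw [pow_succ' T (n + 1), pow_succ' T n]
      exact hT _ _
    have h2 := norm_inner_le_norm (𝕜 := ℂ) ((T ^ n) x) ((T ^ (n + 2)) x)
    rw [← h1, inner_self_eq_norm_sq_to_K] at h2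
    simpa using h2
  by_contra! hlt
  have ha0 : 0 < ‖x‖ := by
    rcases (norm_nonneg x).eq_or_lt with h0 | h0
    · have h1 := hstep 0
      simp only [pow_zero, Module.End.one_apply, ← h0, zero_mul, zero_add, pow_one] at h1
      have : ‖T x‖ = 0 := by
        have := norm_nonneg (T x)
        nlinarith
      rw [← h0, this] at hlt
      simp at hlt
    · exact h0
  set μ := ‖T x‖ / ‖x‖ with hμ
  have hμl : l < μ := by rwa [hμ, lt_div_iff₀ ha0]
  have hμ0 : 0 < μ := hl.trans_lt hμl
  have hgrow : ∀ n, 0 < ‖(T ^ n) x‖ ∧ μ * ‖(T ^ n) x‖ ≤ ‖(T ^ (n + 1)) x‖ := by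
    intro n
    induction n with
    | zero => simp [ha0, hμ, div_mul_cancel₀ _ ha0.ne']
    | succ k ih =>
      have hpos : 0 < ‖(T ^ (k + 1)) x‖ := lt_of_lt_of_le (mul_pos hμ0 ih.1) ih.2
      refine ⟨hpos, ?_⟩
      have h1 := hstep k
      have h2 := mul_le_mul_of_nonneg_right ih.2 hpos.le
      have : ‖(T ^ k) x‖ * (μ * ‖(T ^ (k + 1)) x‖) ≤ ‖(T ^ k) x‖ * ‖(T ^ (k + 2)) x‖ := by
        nlinarith
      exact le_of_mul_le_mul_left this ih.1
  have hlow : ∀ n, μ ^ n * ‖x‖ ≤ ‖(T ^ n) x‖ := by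
    intro n
    induction n with
    | zero => simp
    | succ k ih =>
      calc μ ^ (k + 1) * ‖x‖ = μ * (μ ^ k * ‖x‖) := by ring
        _ ≤ μ * ‖(T ^ k) x‖ := by gcongr
        _ ≤ _ := (hgrow k).2
  have hbound : ∀ n, μ ^ n * ‖x‖ ≤ C * l ^ n := fun n => (hlow n).trans (hC n)
  have hlim : Filter.Tendsto (fun n : ℕ => C * (l / μ) ^ n) Filter.atTop (nhds (C * 0)) :=
    (tendsto_pow_atTop_nhds_zero_of_lt_one (by positivity) ((div_lt_one hμ0).2 hμl)).const_mul C
  have : ‖x‖ ≤ C * 0 := ge_of_tendsto' hlim fun n => by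
    rw [div_pow, ← mul_div_assoc, le_div_iff₀ (by positivity)]
    linarith [hbound n]
  linarith

/-- A contraction `F` with a spectral gap above an approximate eigenvector `f`, followed by an
isometry `U` which moves `f`, is stably non-singular after subtraction from the identity. -/
theorem norm_le_of_gap_of_rotation {E : Type*} [SeminormedAddCommGroup E]
    [InnerProductSpace ℂ E] {F : E →ₗ[ℂ] E} (hF : F.IsSymmetric) (hF1 : ∀ x, ‖F x‖ ≤ ‖x‖)
    (U : E →ₗ[ℂ] E) (hU : ∀ x, ‖U x‖ = ‖x‖) {f : E} (hf : ‖f‖ = 1) {δ σ : ℝ}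
    (hδ0 : 0 < δ) (hδ1 : δ ≤ 1) (hgap : ∀ w, ⟪f, w⟫_ℂ = 0 → ‖F w‖ ≤ (1 - δ) * ‖w‖)
    (hσ0 : 0 < σ) (hσ1 : σ ≤ 1) (hσ : σ ≤ ‖f - U f‖)
    (hr : ‖F f - f‖ ≤ δ * σ ^ 2 / 1000) (x : E) :
    ‖x‖ ≤ 1000 / (δ * σ ^ 2) * ‖x - U (F x)‖ := by
  rw [div_mul_eq_mul_div, le_div_iff₀ (by positivity)]
  set α : ℂ := ⟪f, x⟫_ℂ with hα
  set w : E := x - α • f with hw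
  have hff : ⟪f, f⟫_ℂ = 1 := by simp [inner_self_eq_norm_sq_to_K, hf]
  have hfw : ⟪f, w⟫_ℂ = 0 := by
    rw [hw, inner_sub_right, inner_smul_right, hff, mul_one, sub_self]
  have hx : x = α • f + w := by simp [hw]
  have hxn : ‖x‖ ^ 2 = ‖α‖ ^ 2 + ‖w‖ ^ 2 := by
    have := norm_add_sq (𝕜 := ℂ) (α • f) w
    rw [← hx, inner_smul_left, hfw, norm_smul, hf] at this
    simpa using this
  clear_value w α
  set ρ := ‖F f - f‖ with hρ
  have hρ0 : 0 ≤ ρ := norm_nonneg _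
  have hcross : ‖⟪F f, F w⟫_ℂ‖ ≤ 2 * ρ * ‖w‖ := by
    have h1 : ⟪F f, F w⟫_ℂ = ⟪F (F f - f) + (F f - f), w⟫_ℂ := by
      rw [inner_add_left, inner_sub_left, hfw, map_sub, inner_sub_left, hF f w, hF (F f) w]
      simp
    rw [h1]
    refine (norm_inner_le_norm _ _).trans ?_
    gcongr
    have := hF1 (F f - f)
    have := norm_add_le (F (F f - f)) (F f - f)
    linarith
  have hFx : ‖F x‖ ^ 2 ≤ ‖α‖ ^ 2 + 4 * ‖α‖ * ρ * ‖w‖ + (1 - δ) * ‖w‖ ^ 2 := by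
    have h1 := norm_add_sq (𝕜 := ℂ) (α • F f) (F w)
    rw [← map_smul, ← map_add, ← hx, map_smul, inner_smul_left, norm_smul] at h1
    have h2 : RCLike.re ((starRingEnd ℂ) α * ⟪F f, F w⟫_ℂ) ≤ ‖α‖ * (2 * ρ * ‖w‖) := by
      refine (RCLike.re_le_norm _).trans ?_
      rw [norm_mul, RCLike.norm_conj]
      gcongr
    have h3 : ‖F f‖ ≤ 1 := (hF1 f).trans hf.le
    have h4 : (‖α‖ * ‖F f‖) ^ 2 ≤ ‖α‖ ^ 2 := by
      gcongr
      exact mul_le_of_le_one_right (norm_nonneg _) h3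
    have h5 : ‖F w‖ ^ 2 ≤ (1 - δ) * ‖w‖ ^ 2 := by
      have h6 := hgap w hfw
      have h7 : ‖F w‖ ^ 2 ≤ ((1 - δ) * ‖w‖) ^ 2 := by gcongr
      have h8 : (1 - δ) ^ 2 ≤ 1 - δ := by nlinarith
      calc _ ≤ _ := h7
        _ = (1 - δ) ^ 2 * ‖w‖ ^ 2 := by ring
        _ ≤ _ := by gcongr
    rw [h1]
    linarith
  set ε := ‖x - U (F x)‖ with hε
  have hε0 : 0 ≤ ε := norm_nonneg _
  have hxF : ‖x‖ ≤ ‖F x‖ + ε := by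
    have := norm_add_le (U (F x)) (x - U (F x))
    rw [hU] at this
    simpa using this
  have hαx : ‖α‖ ≤ ‖x‖ := by
    have : ‖α‖ ^ 2 ≤ ‖x‖ ^ 2 := by nlinarith [sq_nonneg ‖w‖]
    exact (pow_le_pow_iff_left₀ (by positivity) (by positivity) two_ne_zero).1 this
  have hwx : ‖w‖ ≤ ‖x‖ := by
    have : ‖w‖ ^ 2 ≤ ‖x‖ ^ 2 := by nlinarith [sq_nonneg ‖α‖]
    exact (pow_le_pow_iff_left₀ (by positivity) (by positivity) two_ne_zero).1 this
  have hw2 : δ * ‖w‖ ^ 2 ≤ 2 * ε * ‖x‖ + 4 * ρ * ‖x‖ ^ 2 := by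
    have h1 : ‖x‖ ^ 2 - ‖F x‖ ^ 2 ≤ 2 * ε * ‖x‖ := by
      have := hF1 x
      have := norm_nonneg (F x)
      nlinarith
    have h2 : 4 * ‖α‖ * ρ * ‖w‖ ≤ 4 * ρ * ‖x‖ ^ 2 := by
      have : ‖α‖ * ‖w‖ ≤ ‖x‖ * ‖x‖ := by gcongr
      nlinarith
    nlinarith
  have hmain : ‖α‖ * σ ≤ ε + ‖α‖ * ρ + 2 * ‖w‖ := by
    have h1 : α • (f - U f) = (x - U (F x)) + α • U (F f - f) + (U (F w) - w) := by
      conv_rhs => rw [hx]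
      simp only [map_add, map_smul, map_sub, smul_sub]
      abel
    have h2 : ‖α • (f - U f)‖ ≤ ε + ‖α‖ * ρ + 2 * ‖w‖ := by
      rw [h1]
      refine (norm_add₃_le).trans ?_
      have h3 : ‖U (F w) - w‖ ≤ 2 * ‖w‖ := by
        refine (norm_sub_le _ _).trans ?_
        rw [hU]
        linarith [hF1 w]
      rw [norm_smul, hU]
      linarith
    rw [norm_smul] at h2
    exact (mul_le_mul_of_nonneg_left hσ (norm_nonneg _)).trans h2
  by_contra! hcon
  have hx0 : 0 < ‖x‖ := by
    by_contra! h
    have : ‖x‖ = 0 := le_antisymm h (norm_nonneg _)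
    rw [this] at hcon
    linarith
  have hσ2 : σ ^ 2 ≤ σ := by nlinarith only [hσ0, hσ1]
  have hδσ : δ * σ ^ 2 ≤ σ :=
    (mul_le_of_le_one_left (sq_nonneg σ) hδ1).trans hσ2
  have hεs : ε ≤ δ * σ ^ 2 / 1000 * ‖x‖ := by linarith only [hcon]
  have hwsmall : ‖w‖ ≤ σ / 8 * ‖x‖ := by
    have h1 : δ * ‖w‖ ^ 2 ≤ δ * (σ / 8 * ‖x‖) ^ 2 := by
      have h2 : 4 * ρ * ‖x‖ ^ 2 ≤ 4 * (δ * σ ^ 2 / 1000) * ‖x‖ ^ 2 := by gcongr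
      have h3 : 2 * ε * ‖x‖ ≤ 2 * (δ * σ ^ 2 / 1000 * ‖x‖) * ‖x‖ := by gcongr
      have h4 : 0 ≤ δ * σ ^ 2 * ‖x‖ ^ 2 := by positivity
      linarith only [hw2, h2, h3, h4]
    exact (pow_le_pow_iff_left₀ (by positivity) (by positivity) two_ne_zero).1 (le_of_mul_le_mul_left h1 hδ0)
  have hαbig : ‖x‖ * (7 / 8) ≤ ‖α‖ := by
    have h1 : ‖w‖ ^ 2 ≤ (1 / 8 * ‖x‖) ^ 2 := by
      refine pow_le_pow_left₀ (norm_nonneg _) (hwsmall.trans ?_) 2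
      gcongr
    refine (pow_le_pow_iff_left₀ (by positivity) (by positivity) two_ne_zero).1 ?_
    linarith only [h1, hxn, sq_nonneg ‖x‖]
  have hρs : ρ ≤ σ / 1000 := by linarith only [hr, hδσ]
  have hεσ : ε ≤ σ / 1000 * ‖x‖ := hεs.trans (by gcongr)
  have h1 : ‖α‖ * ρ ≤ ‖x‖ * (σ / 1000) := by gcongr
  have h2 : ‖x‖ * (7 / 8) * σ ≤ ‖α‖ * σ := by gcongr
  linarith only [mul_pos hx0 hσ0, h1, h2, hεσ, hwsmall, hmain]

namespace Dyson

open scoped ComplexOrder InnerProductSpace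

variable {A : Type*} [CStarAlgebra A] [PartialOrder A] [StarOrderedRing A]

namespace TracialState

variable (φ : TracialState A)

/-- The tracial state as a positive linear functional. -/
def posMap : A →ₚ[ℂ] ℂ :=
  PositiveLinearMap.mk₀ φ.tr fun x hx =>
    Complex.nonneg_iff.2 ⟨(φ.state_pos x hx).1, (φ.state_pos x hx).2.symm⟩

/-- The vector of the pre-Hilbert space `(A, ‖·‖₂)` given by an element of `A`. -/
abbrev toL2 : A ≃ₗ[ℂ] φ.posMap.PreGNS := φ.posMap.toPreGNS

theorem nrm2_eq (x : A) : nrm2 φ x = ‖φ.toL2 x‖ := rfl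

theorem inner_toL2 (x y : A) : ⟪φ.toL2 x, φ.toL2 y⟫_ℂ = φ.tr (star x * y) := rfl

theorem tr_star (x : A) : φ.tr (star x) = starRingEnd ℂ (φ.tr x) := map_star φ.posMap x

theorem nrm2_nonneg (x : A) : 0 ≤ nrm2 φ x := Real.sqrt_nonneg _

theorem tr_star_mul_self_nonneg (x : A) : 0 ≤ (φ.tr (star x * x)).re :=
  (φ.state_pos _ (star_mul_self_nonneg x)).1

theorem nrm2_sq (x : A) : nrm2 φ x ^ 2 = (φ.tr (star x * x)).re :=
  Real.sq_sqrt (φ.tr_star_mul_self_nonneg x)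

theorem nrm2_star (x : A) : nrm2 φ (star x) = nrm2 φ x := by
  rw [nrm2, nrm2, star_star, φ.tracial]

theorem nrm2_add_le (x y : A) : nrm2 φ (x + y) ≤ nrm2 φ x + nrm2 φ y := by
  simp only [nrm2_eq, map_add]
  exact norm_add_le _ _

theorem nrm2_smul (c : ℂ) (x : A) : nrm2 φ (c • x) = ‖c‖ * nrm2 φ x := by
  simp only [nrm2_eq, map_smul, norm_smul]

theorem nrm2_real_smul (c : ℝ) (x : A) : nrm2 φ (c • x) = |c| * nrm2 φ x := by
  rw [← Complex.coe_smul, nrm2_smul, Complex.norm_real, Real.norm_eq_abs]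

theorem norm_tr_star_mul_le (x y : A) : ‖φ.tr (star x * y)‖ ≤ nrm2 φ x * nrm2 φ y :=
  norm_inner_le_norm (𝕜 := ℂ) (φ.toL2 x) (φ.toL2 y)

theorem nrm2_one : nrm2 φ 1 = 1 := by simp [nrm2, φ.unital]

theorem norm_tr_le (x : A) : ‖φ.tr x‖ ≤ nrm2 φ x := by
  simpa [nrm2_one] using φ.norm_tr_star_mul_le 1 x

theorem eq_zero_of_nrm2 {x : A} (h : nrm2 φ x = 0) : x = 0 := by
  have h1 : (φ.tr (star x * x)).re = 0 := by rw [← nrm2_sq, h]; simp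
  have h2 := φ.faithful _ (star_mul_self_nonneg x)
    (Complex.ext h1 (φ.state_pos _ (star_mul_self_nonneg x)).2)
  exact CStarRing.star_mul_self_eq_zero_iff x |>.1 h2

theorem tr_re_mono {x y : A} (h : x ≤ y) : (φ.tr x).re ≤ (φ.tr y).re := by
  have := (φ.state_pos _ (sub_nonneg.2 h)).1
  rw [map_sub, Complex.sub_re] at this
  linarith

theorem tr_eq_re {x : A} (h : IsSelfAdjoint x) : φ.tr x = ((φ.tr x).re : ℂ) := by
  have := φ.tr_star x
  rw [h.star_eq] at this
  exact (Complex.conj_eq_iff_re.1 this.symm).symm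

theorem tr_real_smul (c : ℝ) (x : A) : φ.tr (c • x) = c * φ.tr x := by
  rw [← Complex.coe_smul, map_smul, smul_eq_mul]

theorem tr_real_smul_re (c : ℝ) (x : A) : (φ.tr (c • x)).re = c * (φ.tr x).re := by
  rw [tr_real_smul, Complex.re_ofReal_mul]

theorem tr_mul_nonneg {x y : A} (hx : 0 ≤ x) (hy : 0 ≤ y) : 0 ≤ (φ.tr (x * y)).re := by
  have hs : star (CFC.sqrt y) = CFC.sqrt y := (CFC.sqrt_nonneg y).isSelfAdjoint.star_eq
  have h1 := (φ.state_pos _ (star_left_conjugate_nonneg hx (CFC.sqrt y))).1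
  rwa [φ.tracial, ← mul_assoc, hs, CFC.sqrt_mul_sqrt_self y hy, φ.tracial] at h1

theorem tr_mul_le {x y z : A} (hxy : x ≤ y) (hz : 0 ≤ z) :
    (φ.tr (x * z)).re ≤ (φ.tr (y * z)).re := by
  have := φ.tr_mul_nonneg (sub_nonneg.2 hxy) hz
  rw [sub_mul, map_sub, Complex.sub_re] at this
  linarith

theorem nrm2_mul_left_le (a x : A) : nrm2 φ (a * x) ≤ ‖a‖ * nrm2 φ x := by
  have h := star_left_conjugate_le_conjugate
    (CStarAlgebra.star_mul_le_algebraMap_norm_sq (a := a)) x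
  rw [Algebra.algebraMap_eq_smul_one, mul_smul_comm, mul_one, smul_mul_assoc] at h
  have h2 := φ.tr_re_mono h
  rw [tr_real_smul_re, ← nrm2_sq] at h2
  have h3 : nrm2 φ (a * x) ^ 2 ≤ (‖a‖ * nrm2 φ x) ^ 2 := by
    rw [nrm2_sq, star_mul, mul_pow]
    simpa only [mul_assoc] using h2
  exact (pow_le_pow_iff_left₀ (φ.nrm2_nonneg _)
    (mul_nonneg (norm_nonneg _) (φ.nrm2_nonneg _)) two_ne_zero).1 h3

theorem nrm2_mul_right_le (x b : A) : nrm2 φ (x * b) ≤ ‖b‖ * nrm2 φ x := by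
  rw [← nrm2_star, star_mul, ← norm_star b, ← φ.nrm2_star x]
  exact φ.nrm2_mul_left_le _ _

theorem nrm2_conj_le (a x b : A) : nrm2 φ (a * x * b) ≤ ‖a‖ * ‖b‖ * nrm2 φ x := by
  refine (φ.nrm2_mul_right_le _ _).trans ?_
  rw [mul_comm ‖a‖, mul_assoc]
  gcongr
  exact φ.nrm2_mul_left_le _ _

theorem nrm2_le_norm (x : A) : nrm2 φ x ≤ ‖x‖ := by
  simpa [nrm2_one] using φ.nrm2_mul_left_le x 1

theorem nrm2_unitary_conj {u : A} (h1 : star u * u = 1) (h2 : u * star u = 1) (x : A) :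
    nrm2 φ (u * x * u) = nrm2 φ x := by
  have : star (u * x * u) * (u * x * u) = star u * (star x * x * u) := by
    simp only [star_mul, mul_assoc]
    rw [← mul_assoc (star u) u, h1, one_mul]
  rw [nrm2, nrm2, this, φ.tracial, mul_assoc, h2, mul_one]

theorem nontrivial (φ : TracialState A) : Nontrivial A := by
  refine ⟨⟨1, 0, fun h => ?_⟩⟩
  have := φ.unital
  rw [h, map_zero] at this
  exact zero_ne_one this

end TracialState

theorem isSelfAdjoint_reA (x : A) : IsSelfAdjoint (reA x) := by
  simp [IsSelfAdjoint, reA, add_comm]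

theorem isSelfAdjoint_imA (x : A) : IsSelfAdjoint (imA x) := by
  simp only [IsSelfAdjoint, imA, star_smul, star_sub, star_star]
  rw [← neg_sub x (star x), smul_neg, ← neg_smul]
  congr 1
  simp

theorem reA_add_imA (x : A) : reA x + Complex.I • imA x = x := by
  simp only [reA, imA, smul_smul]
  have : Complex.I * (2 * Complex.I)⁻¹ = (2 : ℂ)⁻¹ := by
    field_simp
  rw [this, ← smul_add, add_add_sub_cancel, ← two_smul ℂ x, smul_smul]
  norm_num

theorem sub_star_eq_imA (x : A) : x - star x = (2 * Complex.I) • imA x := by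
  rw [imA, smul_smul, mul_inv_cancel₀ (by simp), one_smul]

theorem nrm2_reA_le (φ : TracialState A) (x : A) : nrm2 φ (reA x) ≤ nrm2 φ x := by
  have := φ.nrm2_add_le x (star x)
  rw [φ.nrm2_star] at this
  rw [reA, φ.nrm2_smul]
  norm_num
  linarith

theorem nrm2_imA_le (φ : TracialState A) (x : A) : nrm2 φ (imA x) ≤ nrm2 φ x := by
  have := φ.nrm2_add_le x (-star x)
  rw [← neg_one_smul ℂ (star x), φ.nrm2_smul, φ.nrm2_star] at this
  rw [imA, φ.nrm2_smul, sub_eq_add_neg, ← neg_one_smul ℂ (star x)]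
  norm_num at this ⊢
  linarith

theorem nrm2_posPart_le (φ : TracialState A) {x : A} (hx : IsSelfAdjoint x) :
    nrm2 φ x⁺ ≤ nrm2 φ x ∧ nrm2 φ x⁻ ≤ nrm2 φ x := by
  have hp := (CFC.posPart_nonneg x).isSelfAdjoint.star_eq
  have hn := (CFC.negPart_nonneg x).isSelfAdjoint.star_eq
  have h1 : star x * x = star x⁺ * x⁺ + star x⁻ * x⁻ := by
    rw [hp, hn, hx.star_eq]
    conv_lhs => rw [← CFC.posPart_sub_negPart x hx]
    simp [mul_sub, sub_mul]
  have h2 : nrm2 φ x ^ 2 = nrm2 φ x⁺ ^ 2 + nrm2 φ x⁻ ^ 2 := by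
    simp only [φ.nrm2_sq, h1, map_add, Complex.add_re]
  constructor <;>
    refine (pow_le_pow_iff_left₀ (φ.nrm2_nonneg _) (φ.nrm2_nonneg _) two_ne_zero).1 ?_ <;>
    nlinarith [sq_nonneg (nrm2 φ x⁺), sq_nonneg (nrm2 φ x⁻)]

section PosPreserving

variable {S : A →L[ℂ] A}

theorem PosPreserving.isSelfAdjoint (hS : PosPreserving S) {x : A} (hx : IsSelfAdjoint x) :
    IsSelfAdjoint (S x) := by
  rw [← CFC.posPart_sub_negPart x hx, map_sub]
  exact (hS _ (CFC.posPart_nonneg x)).isSelfAdjoint.sub (hS _ (CFC.negPart_nonneg x)).isSelfAdjoint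

theorem PosPreserving.map_star (hS : PosPreserving S) (x : A) : S (star x) = star (S x) := by
  have h1 := (hS.isSelfAdjoint (isSelfAdjoint_reA x)).star_eq
  have h2 := (hS.isSelfAdjoint (isSelfAdjoint_imA x)).star_eq
  have h3 := (isSelfAdjoint_reA x).star_eq
  have h4 := (isSelfAdjoint_imA x).star_eq
  conv_lhs => rw [← reA_add_imA x]
  conv_rhs => rw [← reA_add_imA x]
  simp only [star_add, star_smul, h3, h4, map_add, map_smul, h1, h2]

theorem PosPreserving.mono (hS : PosPreserving S) {x y : A} (h : x ≤ y) : S x ≤ S y := by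
  have := hS _ (sub_nonneg.2 h)
  rwa [map_sub, sub_nonneg] at this

theorem norm_le_of_le_smul_one {x : A} (hx : 0 ≤ x) {c : ℝ} (h : x ≤ c • 1) (hc : 0 ≤ c) :
    ‖x‖ ≤ c := by
  rwa [CStarAlgebra.norm_le_iff_le_algebraMap x hc hx, Algebra.algebraMap_eq_smul_one]

variable {φ : TracialState A} {c₁ c₂ : ℝ}

/-- A flat operator maps `L²` into the algebra. -/
theorem IsFlat.norm_apply_le (hS : PosPreserving S) (h : IsFlat φ S c₁ c₂) (hc : 0 ≤ c₂) (x : A) :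
    ‖S x‖ ≤ 4 * c₂ * nrm2 φ x := by
  have hpos : ∀ y : A, 0 ≤ y → ‖S y‖ ≤ c₂ * nrm2 φ y := by
    intro y hy
    have h1 := (h y hy).2
    rw [Complex.coe_smul] at h1
    have h0 := (φ.state_pos y hy).1
    refine (norm_le_of_le_smul_one (hS y hy) h1 (mul_nonneg hc h0)).trans ?_
    gcongr
    exact (Complex.re_le_norm _).trans (φ.norm_tr_le y)
  have hsa : ∀ y : A, IsSelfAdjoint y → ‖S y‖ ≤ 2 * c₂ * nrm2 φ y := by
    intro y hy
    obtain ⟨hp, hn⟩ := nrm2_posPart_le φ hy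
    have h1 := hpos _ (CFC.posPart_nonneg y)
    have h2 := hpos _ (CFC.negPart_nonneg y)
    have h3 := mul_le_mul_of_nonneg_left hp hc
    have h4 := mul_le_mul_of_nonneg_left hn hc
    have h5 := norm_sub_le (S y⁺) (S y⁻)
    rw [← map_sub, CFC.posPart_sub_negPart y hy] at h5
    linarith
  have h1 := hsa _ (isSelfAdjoint_reA x)
  have h2 := hsa _ (isSelfAdjoint_imA x)
  have h3 := mul_le_mul_of_nonneg_left (nrm2_reA_le φ x) hc
  have h4 := mul_le_mul_of_nonneg_left (nrm2_imA_le φ x) hc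
  have h5 := norm_add_le (S (reA x)) (Complex.I • S (imA x))
  rw [← map_smul, ← map_add, reA_add_imA, map_smul, norm_smul, Complex.norm_I] at h5
  linarith

end PosPreserving

section Inverse

theorem one_le_norm_sq_smul_mul_star {x y : A} (h : x * y = 1) :
    (1 : A) ≤ ‖y‖ ^ 2 • (x * star x) := by
  have h1 := star_right_conjugate_le_conjugate
    (CStarAlgebra.mul_star_le_algebraMap_norm_sq (a := y)) x
  rw [Algebra.algebraMap_eq_smul_one, mul_smul_comm, mul_one, smul_mul_assoc, ← mul_assoc, h,
    one_mul, ← star_mul, h, star_one] at h1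
  exact h1

theorem isSelfAdjoint_of_inverse {h h' : A} (h0 : IsSelfAdjoint h) (h1 : h * h' = 1) :
    IsSelfAdjoint h' := by
  have h3 : star h' * h = 1 := by
    nth_rewrite 1 [← h0.star_eq]
    rw [← star_mul, h1, star_one]
  exact left_inv_eq_right_inv h3 h1

theorem exists_inverse_of_smul_one_le {h : A} {c : ℝ} (hc : 0 < c) (hle : c • (1 : A) ≤ h) :
    ∃ h' : A, h * h' = 1 ∧ h' * h = 1 ∧ ‖h'‖ ≤ c⁻¹ := by
  have hpos : 0 ≤ h := (smul_nonneg hc.le zero_le_one).trans hle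
  have hc1 : IsStrictlyPositive (c • (1 : A)) := by
    refine ⟨smul_nonneg hc.le zero_le_one, ?_⟩
    exact (Units.mk0 c hc.ne' • (1 : Aˣ)).isUnit
  obtain ⟨w, rfl⟩ := CStarAlgebra.isUnit_of_le _ hle hc1
  refine ⟨↑w⁻¹, w.mul_inv, w.inv_mul, ?_⟩
  have hsa : IsSelfAdjoint (↑w⁻¹ : A) :=
    isSelfAdjoint_of_inverse hpos.isSelfAdjoint w.mul_inv
  have h1 := hsa.conjugate_le_conjugate hle
  rw [mul_smul_comm, mul_one, smul_mul_assoc, w.inv_mul, one_mul] at h1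
  have h2 : 0 ≤ (↑w⁻¹ : A) * ↑w⁻¹ := by
    simpa [hsa.star_eq] using star_mul_self_nonneg (↑w⁻¹ : A)
  have h3 := CStarAlgebra.norm_le_norm_of_nonneg_of_le (smul_nonneg hc.le h2) h1
  have h4 : ‖(↑w⁻¹ : A) * ↑w⁻¹‖ = ‖(↑w⁻¹ : A)‖ * ‖(↑w⁻¹ : A)‖ := by
    simpa [hsa.star_eq] using CStarRing.norm_star_mul_self (x := (↑w⁻¹ : A))
  rw [norm_smul, h4, Real.norm_of_nonneg hc.le] at h3
  rcases (norm_nonneg (↑w⁻¹ : A)).eq_or_lt with h0 | h0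
  · rw [← h0]; positivity
  · rw [← mul_assoc] at h3
    rw [inv_eq_one_div c, le_div_iff₀' hc]
    exact (mul_le_iff_le_one_left h0).1 h3

theorem exists_sqrt_of_inverse {h h' : A} (h0 : 0 ≤ h) (h1 : h * h' = 1) (h2 : h' * h = 1) :
    ∃ k k' : A, 0 ≤ k ∧ 0 ≤ k' ∧ k * k = h ∧ k' * k' = h' ∧ k * k' = 1 ∧ k' * k = 1 ∧
      ‖k‖ ^ 2 = ‖h‖ ∧ ‖k'‖ ^ 2 = ‖h'‖ ∧ ∀ y, Commute h y → Commute k y := by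
  set k := CFC.sqrt h
  have hk0 : 0 ≤ k := CFC.sqrt_nonneg h
  have hkk : k * k = h := CFC.sqrt_mul_sqrt_self h h0
  have hkh : h * k = k * h := by rw [← hkk, mul_assoc]
  have hkk' : k * (k * h') = 1 := by rw [← mul_assoc, hkk, h1]
  have hk'k : (k * h') * k = 1 := by
    have : h' * k = k * h' := by
      calc h' * k = h' * (k * h) * h' := by rw [mul_assoc, mul_assoc, h1, mul_one]
        _ = k * h' := by rw [← hkh, ← mul_assoc, h2, one_mul]
    rw [mul_assoc, this, hkk']
  have hsa : IsSelfAdjoint (k * h') := isSelfAdjoint_of_inverse hk0.isSelfAdjoint hkk'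
  have hk'k' : k * h' * (k * h') = h' := by
    rw [← mul_assoc, hk'k, one_mul]
  refine ⟨k, k * h', hk0, ?_, hkk, hk'k', hkk', hk'k, ?_, ?_, fun y hy => ?_⟩
  · have := hsa.conjugate_nonneg hk0
    rwa [hk'k, one_mul] at this
  · rw [← hkk, sq, ← CStarRing.norm_star_mul_self, hk0.isSelfAdjoint.star_eq]
  · rw [sq, ← CStarRing.norm_star_mul_self, hsa.star_eq, hk'k']
  · exact Commute.cfcₙ_nnreal hy _

end Inverse

/-- The balanced polar decomposition `m = q* u q` of an invertible element with positive definite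
imaginary part `s h`, where `f` is `Im u / s`. -/
theorem exists_balanced_polar {m n h : A} {s L : ℝ} (hL : 1 ≤ L) (hmn : m * n = -1)
    (hnm : n * m = -1) (hm : ‖m‖ ≤ L) (hn : ‖n‖ ≤ L)
    (hlow : m * star m ≤ L • h) (hup : h ≤ L • (m * star m)) (him : imA m = s • h) :
    ∃ q q' u f f' : A, q * q' = 1 ∧ q' * q = 1 ∧ star u * u = 1 ∧ u * star u = 1 ∧
      m = star q * u * q ∧ 0 ≤ f ∧ 0 ≤ f' ∧ f * f' = 1 ∧ f' * f = 1 ∧ ‖f‖ ≤ L ^ 4 ∧ ‖f'‖ ≤ L ^ 4 ∧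
      ‖q‖ ^ 2 ≤ L ^ 7 ∧ ‖q'‖ ^ 2 ≤ L ^ 7 ∧ star q * f * q = h ∧
      q * n * h * star n * star q = f ∧
      f - u * f * u = (-(2 * Complex.I * s)) • (u * (f * f)) := by
  have hL0 : 0 < L := by linarith
  have hn2 : (1 : A) ≤ L ^ 2 • (m * star m) := by
    refine (one_le_norm_sq_smul_mul_star (x := m) (y := -n) (by rw [mul_neg, hmn, neg_neg])).trans ?_
    refine smul_le_smul_of_nonneg_right ?_ (mul_star_self_nonneg m)
    rw [norm_neg]
    gcongr
  have hge : (L ^ 3)⁻¹ • (1 : A) ≤ h := by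
    rw [inv_smul_le_iff_of_pos (show 0 < L ^ 3 by positivity)]
    refine hn2.trans ?_
    rw [show L ^ 3 = L ^ 2 * L by ring, mul_smul]
    exact smul_le_smul_of_nonneg_left hlow (show 0 ≤ L ^ 2 by positivity)
  have hpos : 0 ≤ h := (smul_nonneg (by positivity) zero_le_one).trans hge
  have hnormh : ‖h‖ ≤ L ^ 3 := by
    have h1 := CStarAlgebra.norm_le_norm_of_nonneg_of_le hpos hup
    rw [norm_smul, Real.norm_of_nonneg hL0.le, CStarRing.norm_self_mul_star] at h1
    calc ‖h‖ ≤ L * (‖m‖ * ‖m‖) := h1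
      _ ≤ L * (L * L) := by gcongr
      _ = L ^ 3 := by ring
  obtain ⟨h', hh', hh'2, hnormh'⟩ := exists_inverse_of_smul_one_le (c := (L ^ 3)⁻¹) (by positivity) hge
  rw [inv_inv] at hnormh'
  obtain ⟨k, k', hk0, hk'0, hkk, hk'k', e1, e2, nk, nk', -⟩ := exists_sqrt_of_inverse hpos hh' hh'2
  have sk := hk0.isSelfAdjoint.star_eq
  have sk' := hk'0.isSelfAdjoint.star_eq
  have e1r : ∀ y : A, k * (k' * y) = y := fun y => by rw [← mul_assoc, e1, one_mul]
  have e2r : ∀ y : A, k' * (k * y) = y := fun y => by rw [← mul_assoc, e2, one_mul]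
  have hmnr : ∀ y : A, m * (n * y) = -y := fun y => by rw [← mul_assoc, hmn, neg_one_mul]
  have hnmr : ∀ y : A, n * (m * y) = -y := fun y => by rw [← mul_assoc, hnm, neg_one_mul]
  obtain ⟨X, hX⟩ : ∃ X, X = k' * m * k' := ⟨_, rfl⟩
  obtain ⟨Y, hY⟩ : ∃ Y, Y = -(k * n * k) := ⟨_, rfl⟩
  have hXY : X * Y = 1 := by simp [hX, hY, mul_assoc, e2r, hmnr, e2]
  have hYX : Y * X = 1 := by simp [hX, hY, mul_assoc, e1r, hnmr, e1]
  have hmX : m = k * X * k := by simp [hX, mul_assoc, e1r, e2]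
  have hnY : n = -(k' * Y * k') := by simp [hY, mul_assoc, e2r, e1]
  have hXs : star X = X - (2 * Complex.I * s) • 1 := by
    have h1 : k' * h * k' = 1 := by rw [← hkk]; simp [e2r, e1]
    have h2 : X - star X = k' * (m - star m) * k' := by
      simp only [hX, star_mul, sk', mul_sub, sub_mul, mul_assoc]
    rw [sub_star_eq_imA m, him, ← Complex.coe_smul, smul_smul, mul_smul_comm, smul_mul_assoc, h1]
      at h2
    rw [← h2, sub_sub_cancel]
  have hcomm : X * star X = star X * X := by
    rw [hXs]; simp [mul_sub, sub_mul]
  have nX : ‖X‖ ≤ L ^ 4 := by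
    calc ‖X‖ ≤ ‖k'‖ * ‖m‖ * ‖k'‖ := hX ▸ norm_mul₃_le
      _ = ‖k'‖ ^ 2 * ‖m‖ := by ring
      _ ≤ L ^ 3 * L := by rw [nk']; gcongr
      _ = L ^ 4 := by ring
  have nY : ‖Y‖ ≤ L ^ 4 := by
    calc ‖Y‖ ≤ ‖k‖ * ‖n‖ * ‖k‖ := by rw [hY, norm_neg]; exact norm_mul₃_le
      _ = ‖k‖ ^ 2 * ‖n‖ := by ring
      _ ≤ L ^ 3 * L := by rw [nk]; gcongr
      _ = L ^ 4 := by ring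
  have hT1 : star X * X * (Y * star Y) = 1 := by
    rw [mul_assoc, ← mul_assoc X, hXY, one_mul, ← star_mul, hYX, star_one]
  have hT2 : Y * star Y * (star X * X) = 1 := by
    rw [mul_assoc, ← mul_assoc (star Y), ← star_mul, hXY, star_one, one_mul, hYX]
  obtain ⟨t, t', ht0, ht'0, htt, ht't', et1, et2, nt, nt', ct⟩ :=
    exists_sqrt_of_inverse (star_mul_self_nonneg X) hT1 hT2
  obtain ⟨l, l', hl0, hl'0, hll, hl'l', el1, el2, nl, nl', cl⟩ :=
    exists_sqrt_of_inverse ht0 et1 et2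
  have ctX : t * X = X * t := ct X (by rw [commute_iff_eq, ← mul_assoc, hcomm])
  have clX : l * X = X * l := cl X ctX
  have sl := hl0.isSelfAdjoint.star_eq
  have st' := ht'0.isSelfAdjoint.star_eq
  have ct'X : t' * X = X * t' := by
    calc t' * X = t' * (X * t) * t' := by rw [mul_assoc, mul_assoc, et1, mul_one]
      _ = X * t' := by rw [← ctX, ← mul_assoc, et2, one_mul]
  have et2r : ∀ y : A, t' * (t * y) = y := fun y => by rw [← mul_assoc, et2, one_mul]
  have el1r : ∀ y : A, l * (l' * y) = y := fun y => by rw [← mul_assoc, el1, one_mul]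
  have el2r : ∀ y : A, l' * (l * y) = y := fun y => by rw [← mul_assoc, el2, one_mul]
  have clXr : ∀ y : A, l * (X * y) = X * (l * y) := fun y => by
    rw [← mul_assoc, clX, mul_assoc]
  have ct'Xr : ∀ y : A, t' * (X * y) = X * (t' * y) := fun y => by
    rw [← mul_assoc, ct'X, mul_assoc]
  have nt1 : ‖t‖ ≤ L ^ 4 := by
    rw [CStarRing.norm_star_mul_self, ← sq] at nt
    rwa [(pow_left_inj₀ (norm_nonneg _) (norm_nonneg _) two_ne_zero).1 nt]
  have nt'1 : ‖t'‖ ≤ L ^ 4 := by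
    rw [CStarRing.norm_self_mul_star, ← sq] at nt'
    rwa [(pow_left_inj₀ (norm_nonneg _) (norm_nonneg _) two_ne_zero).1 nt']
  have hlt'l : l * (t' * l) = 1 := by rw [← hl'l', mul_assoc, el1r, el2]
  have hsX : star X * t' * t' = Y := by
    have : X * (star X * t' * t') = 1 := by
      rw [mul_assoc (star X), ← mul_assoc, hcomm, ← htt, mul_assoc, ← mul_assoc t t' t', et1, one_mul, et1]
    calc star X * t' * t' = Y * (X * (star X * t' * t')) := by rw [← mul_assoc, hYX, one_mul]
      _ = Y := by rw [this, mul_one]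
  refine ⟨l * k, k' * l', X * t', t', t, ?_, ?_, ?_, ?_, ?_, ht'0, ht0, et2, et1, nt'1, nt1, ?_, ?_,
    ?_, ?_, ?_⟩
  · simp only [mul_assoc, e1r, el1]
  · simp only [mul_assoc, el2r, e2]
  · rw [star_mul, st', mul_assoc, ← mul_assoc (star X), ← htt]
    simp only [mul_assoc, et2r, et1]
  · rw [star_mul, st', mul_assoc, ← mul_assoc t', ht't', mul_assoc, ← star_mul, hXY, star_one]
    simp [hXY]
  · rw [star_mul, sl, sk]
    simp only [mul_assoc, clXr]
    rw [← mul_assoc t', ← mul_assoc l, hlt'l, one_mul, ← mul_assoc, ← hmX]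
  · calc ‖l * k‖ ^ 2 ≤ (‖l‖ * ‖k‖) ^ 2 := by gcongr; exact norm_mul_le _ _
      _ = ‖t‖ * ‖h‖ := by rw [mul_pow, nl, nk]
      _ ≤ L ^ 4 * L ^ 3 := by gcongr
      _ = L ^ 7 := by ring
  · calc ‖k' * l'‖ ^ 2 ≤ (‖k'‖ * ‖l'‖) ^ 2 := by gcongr; exact norm_mul_le _ _
      _ = ‖h'‖ * ‖t'‖ := by rw [mul_pow, nl', nk']
      _ ≤ L ^ 3 * L ^ 4 := by gcongr
      _ = L ^ 7 := by ring
  · rw [star_mul, sl, sk, mul_assoc, mul_assoc, ← mul_assoc t', ← mul_assoc l, hlt'l, one_mul, hkk]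
  · have h1 : star n = -(k' * star Y * k') := by
      rw [hnY, star_neg, star_mul, star_mul, sk', mul_assoc]
    have h2 : Y * (star Y * l) = t' * (t' * l) := by rw [← mul_assoc, ← ht't', mul_assoc]
    rw [h1, hnY, ← hkk, star_mul, sk, sl]
    simp only [mul_assoc, neg_mul, mul_neg, neg_neg, e1r, e2r, h2]
    rw [← hl'l']
    simp only [mul_assoc, el1r, el2, mul_one]
  · have h1 : t' = X * (star X * (t' * (t' * t'))) := by
      have h2 : star X * (t' * (t' * t')) = Y * t' := by rw [← hsX]; simp only [mul_assoc]
      rw [h2, ← mul_assoc, hXY, one_mul]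
    have h3 : X * t' * t' * (X * t') = X * (X * (t' * (t' * t'))) := by
      simp only [mul_assoc, ct'Xr]
    rw [h3]
    nth_rewrite 1 [h1]
    rw [hXs, ← mul_sub, ← sub_mul, sub_sub_cancel_left, neg_mul, smul_mul_assoc, one_mul, mul_neg,
      mul_smul_comm, neg_smul]
    simp only [mul_assoc]
section Comparison

theorem norm_le_of_neg_le_of_le {y g : A} (h1 : -g ≤ y) (h2 : y ≤ g) : ‖y‖ ≤ 3 * ‖g‖ := by
  have h3 : ‖y + g‖ ≤ ‖g + g‖ :=
    CStarAlgebra.norm_le_norm_of_nonneg_of_le (by rwa [← neg_le_iff_add_nonneg])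
      (add_le_add_left h2 g)
  have h4 := norm_add_le g g
  have h5 := norm_sub_le (y + g) g
  rw [add_sub_cancel_right] at h5
  linarith

variable {φ : TracialState A} {T : A →L[ℂ] A}

theorem map_real_smul (T : A →L[ℂ] A) (r : ℝ) (x : A) : T (r • x) = r • T x := by
  rw [← Complex.coe_smul, map_smul, Complex.coe_smul]

theorem PosPreserving.pow_apply_le (hT : PosPreserving T) {f x : A} {l C : ℝ} (hl : 0 ≤ l)
    (hC : 0 ≤ C) (hf : T f ≤ l • f) (hx : x ≤ C • f) (n : ℕ) :
    (T ^ n) x ≤ (C * l ^ n) • f := by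
  induction n with
  | zero => simpa using hx
  | succ n ih =>
    rw [pow_succ', mul_apply_eq_comp]
    refine (hT.mono ih).trans ?_
    rw [map_real_smul, pow_succ, ← mul_assoc, mul_smul (C * l ^ n) l f]
    exact smul_le_smul_of_nonneg_left hf (mul_nonneg hC (pow_nonneg hl n))

theorem PosPreserving.exists_norm_pow_apply_le (hT : PosPreserving T) {f : A} {l ε : ℝ}
    (hl : 0 ≤ l) (hε : 0 < ε) (hf1 : ε • 1 ≤ f) (hf : T f ≤ l • f) (x : A) :
    ∃ C, ∀ n, ‖(T ^ n) x‖ ≤ C * l ^ n := by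
  have hsa : ∀ y : A, IsSelfAdjoint y → ∃ C, ∀ n, ‖(T ^ n) y‖ ≤ C * l ^ n := by
    intro y hy
    have key : ∀ c : ℝ, c ≤ ‖y‖ → c • (1 : A) ≤ (‖y‖ / ε) • f := fun c hc =>
      calc c • (1 : A) ≤ ‖y‖ • (1 : A) := smul_le_smul_of_nonneg_right hc zero_le_one
        _ = (‖y‖ / ε) • (ε • (1 : A)) := by rw [smul_smul, div_mul_cancel₀ _ hε.ne']
        _ ≤ (‖y‖ / ε) • f := smul_le_smul_of_nonneg_left hf1 (by positivity)
    have h1 : y ≤ (‖y‖ / ε) • f := by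
      refine le_trans ?_ (key _ le_rfl)
      simpa [Algebra.algebraMap_eq_smul_one] using hy.le_algebraMap_norm_self
    have h2 : -y ≤ (‖y‖ / ε) • f := by
      refine le_trans ?_ (key _ le_rfl)
      rw [neg_le]
      simpa [Algebra.algebraMap_eq_smul_one] using hy.neg_algebraMap_norm_le_self
    refine ⟨3 * (‖y‖ / ε * ‖f‖), fun n => ?_⟩
    have h3 := hT.pow_apply_le hl (by positivity) hf h1 n
    have h4 := hT.pow_apply_le hl (by positivity) hf h2 n
    rw [map_neg, neg_le] at h4
    refine (norm_le_of_neg_le_of_le h4 h3).trans (le_of_eq ?_)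
    rw [norm_smul, Real.norm_of_nonneg (by positivity)]
    ring
  obtain ⟨C, hC⟩ := hsa _ (isSelfAdjoint_reA x)
  obtain ⟨D, hD⟩ := hsa _ (isSelfAdjoint_imA x)
  refine ⟨C + D, fun n => ?_⟩
  conv_lhs => rw [← reA_add_imA x, map_add, map_smul]
  refine (norm_add_le _ _).trans ?_
  rw [norm_smul, Complex.norm_I, one_mul, add_mul]
  exact add_le_add (hC n) (hD n)

/-- The map induced by `T` on the pre-Hilbert space `(A, ‖·‖₂)`. -/
abbrev onL2 (φ : TracialState A) (T : A →L[ℂ] A) : φ.posMap.PreGNS →ₗ[ℂ] φ.posMap.PreGNS :=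
  φ.toL2.conj T.toLinearMap

theorem onL2_toL2 (T : A →L[ℂ] A) (x : A) : onL2 φ T (φ.toL2 x) = φ.toL2 (T x) := by
  simp [onL2, LinearEquiv.conj_apply]

theorem onL2_pow_toL2 (T : A →L[ℂ] A) (n : ℕ) (x : A) :
    (onL2 φ T ^ n) (φ.toL2 x) = φ.toL2 ((T ^ n) x) := by
  induction n with
  | zero => simp
  | succ n ih =>
    rw [pow_succ', pow_succ', Module.End.mul_apply, ih, onL2_toL2, mul_apply_eq_comp]

theorem SymmOp.isSymmetric_onL2 (hT : SymmOp φ T) : (onL2 φ T).IsSymmetric := by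
  intro x y
  obtain ⟨x, rfl⟩ := φ.toL2.surjective x
  obtain ⟨y, rfl⟩ := φ.toL2.surjective y
  rw [onL2_toL2, onL2_toL2, TracialState.inner_toL2, TracialState.inner_toL2]
  exact hT x y

/-- A symmetric positivity-preserving map with a strictly positive `l`-superharmonic element has
`L²`-norm at most `l`. -/
theorem PosPreserving.nrm2_apply_le (hT : PosPreserving T) (hs : SymmOp φ T) {f : A} {l ε : ℝ}
    (hl : 0 ≤ l) (hε : 0 < ε) (hf1 : ε • 1 ≤ f) (hf : T f ≤ l • f) (x : A) :
    nrm2 φ (T x) ≤ l * nrm2 φ x := by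
  rw [φ.nrm2_eq, φ.nrm2_eq, ← onL2_toL2]
  refine hs.isSymmetric_onL2.norm_apply_le_of_pow hl _ ?_
  obtain ⟨C, hC⟩ := hT.exists_norm_pow_apply_le hl hε hf1 hf x
  refine ⟨C, fun n => ?_⟩
  rw [onL2_pow_toL2, ← φ.nrm2_eq]
  exact (φ.nrm2_le_norm _).trans (hC n)

theorem exists_sub_apply_eq (G : A →L[ℂ] A) {l B : ℝ} (hl0 : 0 ≤ l) (hl1 : l < 1) (hB : 0 ≤ B)
    (h2 : ∀ x, nrm2 φ (G x) ≤ l * nrm2 φ x) (hinf : ∀ x, ‖G x‖ ≤ B * nrm2 φ x) (x : A) :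
    ∃ y, y - G y = x := by
  have hpow : ∀ n x, nrm2 φ ((G ^ n) x) ≤ l ^ n * nrm2 φ x := by
    intro n
    induction n with
    | zero => simp
    | succ n ih =>
      intro x
      rw [pow_succ', mul_apply_eq_comp, pow_succ', mul_assoc]
      exact (h2 _).trans (mul_le_mul_of_nonneg_left (ih x) hl0)
  obtain ⟨n, hn⟩ : ∃ n : ℕ, B * l ^ n < 1 := by
    have := (tendsto_pow_atTop_nhds_zero_of_lt_one hl0 hl1).const_mul B
    rw [mul_zero] at this
    exact (this.eventually_lt_const one_pos).exists
  have hnorm : ‖G ^ (n + 1)‖ < 1 := by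
    refine lt_of_le_of_lt (ContinuousLinearMap.opNorm_le_bound _ (by positivity) fun y => ?_) hn
    rw [pow_succ', mul_apply_eq_comp, mul_assoc]
    refine (hinf _).trans (mul_le_mul_of_nonneg_left ((hpow n y).trans ?_) hB)
    exact mul_le_mul_of_nonneg_left (φ.nrm2_le_norm y) (by positivity)
  have hu : IsUnit (1 - G ^ (n + 1)) := isUnit_one_sub_of_norm_lt_one hnorm
  rw [← mul_neg_geom_sum] at hu
  obtain ⟨w, hw⟩ := hu
  refine ⟨(∑ i ∈ Finset.range (n + 1), G ^ i) ((↑w⁻¹ : A →L[ℂ] A) x), ?_⟩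
  have h3 : (w : A →L[ℂ] A) ((↑w⁻¹ : A →L[ℂ] A) x) = x := by
    rw [← mul_apply_eq_comp, w.mul_inv, one_apply_eq_self]
  rw [hw, mul_apply_eq_comp] at h3
  exact h3

end Comparison
section Sandwich

variable {φ : TracialState A} {S : A →L[ℂ] A}

/-- The map `x ↦ q S(q* x q) q*`. -/
def sandwich (q : A) (S : A →L[ℂ] A) : A →L[ℂ] A :=
  ContinuousLinearMap.mulLeftRight ℂ A q (star q) ∘L S ∘L
    ContinuousLinearMap.mulLeftRight ℂ A (star q) q

theorem sandwich_apply (q x : A) : sandwich q S x = q * S (star q * x * q) * star q := by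
  simp [sandwich]

theorem PosPreserving.sandwich (hS : PosPreserving S) (q : A) : PosPreserving (sandwich q S) :=
  fun x hx => by
    rw [sandwich_apply]
    exact star_right_conjugate_nonneg (hS _ (star_left_conjugate_nonneg hx q)) q

theorem SymmOp.sandwich (hS : SymmOp φ S) (q : A) : SymmOp φ (sandwich q S) := by
  intro x y
  rw [sandwich_apply, sandwich_apply]
  have h := hS (star q * x * q) (star q * y * q)
  simp only [star_mul, star_star, mul_assoc] at h ⊢
  rw [φ.tracial q]
  have h3 : star x * (q * (S (star q * (y * q)) * star q))
      = star x * (q * S (star q * (y * q))) * star q := by simp only [mul_assoc]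
  rw [h3, φ.tracial _ (star q)]
  simpa only [mul_assoc] using h

/-- The rank-one map `x ↦ ⟨f x⟩ f`. -/
def rankOne (φ : TracialState A) (f : A) : A →L[ℂ] A :=
  ((⟨φ.tr, φ.cont⟩ : A →L[ℂ] ℂ) ∘L ContinuousLinearMap.mul ℂ A f).smulRight f

theorem rankOne_apply (f x : A) : rankOne φ f x = φ.tr (f * x) • f := rfl

theorem symmOp_rankOne {f : A} (hf : IsSelfAdjoint f) : SymmOp φ (rankOne φ f) := by
  intro x y
  rw [rankOne_apply, rankOne_apply, star_smul, smul_mul_assoc, map_smul, mul_smul_comm, map_smul,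
    hf.star_eq, smul_eq_mul, smul_eq_mul, mul_comm]
  congr 1
  rw [← hf.star_eq, ← star_star x, ← star_mul, φ.tr_star, star_star, starRingEnd_apply, star_star,
    hf.star_eq]

theorem SymmOp.sub_real_smul {T T' : A →L[ℂ] A} (hT : SymmOp φ T) (hT' : SymmOp φ T') (r : ℝ) :
    SymmOp φ (T - (r : ℂ) • T') := by
  intro x y
  simp only [sub_apply, smul_apply, star_sub, sub_mul,
    mul_sub, map_sub, star_smul, smul_mul_assoc, mul_smul_comm, map_smul, hT x y, hT' x y]
  simp

variable {c₁ c₂ L : ℝ} {q q' : A}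

theorem IsFlat.tr_smul_one_le_sandwich (h : IsFlat φ S c₁ c₂) (hL : 1 ≤ L) (hc₁ : L⁻¹ ≤ c₁)
    (hq : q * q' = 1) (hq' : ‖q'‖ ^ 2 ≤ L ^ 7) {x : A} (hx : 0 ≤ x) :
    ((L ^ 15)⁻¹ * (φ.tr x).re) • (1 : A) ≤ sandwich q S x := by
  have hL0 : 0 < L := by linarith
  have hqq : (1 : A) ≤ L ^ 7 • (q * star q) :=
    (one_le_norm_sq_smul_mul_star hq).trans
      (smul_le_smul_of_nonneg_right hq' (mul_star_self_nonneg q))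
  have htr : (φ.tr x).re ≤ L ^ 7 * (φ.tr (star q * x * q)).re := by
    have := φ.tr_mul_le hqq hx
    rwa [one_mul, smul_mul_assoc, φ.tr_real_smul_re, mul_assoc, φ.tracial q] at this
  have h0 : 0 ≤ (φ.tr x).re := (φ.state_pos x hx).1
  have h1 := (h _ (star_left_conjugate_nonneg hx q)).1
  rw [Complex.coe_smul] at h1
  have h2 := star_right_conjugate_le_conjugate h1 q
  rw [← sandwich_apply, mul_smul_comm, mul_one, smul_mul_assoc] at h2
  refine le_trans ?_ h2
  have h3 : (L ^ 15)⁻¹ * (φ.tr x).re * L ^ 7 ≤ c₁ * (φ.tr (star q * x * q)).re := by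
    have h4 : (φ.tr x).re * (L ^ 7)⁻¹ ≤ (φ.tr (star q * x * q)).re := by
      rw [← div_eq_mul_inv, div_le_iff₀ (by positivity)]
      linarith
    calc (L ^ 15)⁻¹ * (φ.tr x).re * L ^ 7 = L⁻¹ * ((φ.tr x).re * (L ^ 7)⁻¹) := by field_simp
      _ ≤ c₁ * (φ.tr (star q * x * q)).re := by gcongr; exact (inv_nonneg.2 hL0.le).trans hc₁
  calc ((L ^ 15)⁻¹ * (φ.tr x).re) • (1 : A)
      ≤ ((L ^ 15)⁻¹ * (φ.tr x).re) • (L ^ 7 • (q * star q)) :=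
        smul_le_smul_of_nonneg_left hqq (mul_nonneg (by positivity) h0)
    _ = ((L ^ 15)⁻¹ * (φ.tr x).re * L ^ 7) • (q * star q) := by rw [smul_smul]
    _ ≤ _ := smul_le_smul_of_nonneg_right h3 (mul_star_self_nonneg q)

theorem inv_smul_one_le_of_inverse {f f' : A} (hL : 0 < L) (hf : 0 ≤ f) (h1 : f * f' = 1)
    (h2 : f' * f = 1) (hf' : ‖f'‖ ≤ L) : L⁻¹ • (1 : A) ≤ f := by
  rw [inv_smul_le_iff_of_pos hL]
  obtain ⟨k, k', hk, -, hkk, -, e1, -, -, n2, -⟩ := exists_sqrt_of_inverse hf h1 h2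
  have h3 := one_le_norm_sq_smul_mul_star e1
  rw [hk.isSelfAdjoint.star_eq, hkk, n2] at h3
  exact h3.trans (smul_le_smul_of_nonneg_right hf' hf)

end Sandwich
section Core

variable {φ : TracialState A} {S : A →L[ℂ] A} {c₁ c₂ L θ : ℝ} {q q' f f' : A}

theorem sandwich_apply_le (hL : 1 ≤ L) (hq : q * q' = 1) (hq' : ‖q'‖ ^ 2 ≤ L ^ 7) (hθ : 0 ≤ θ)
    (hf : 0 ≤ f) (hfL : ‖f‖ ≤ L ^ 4) (hF : sandwich q S f = f - θ • (q * star q)) :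
    sandwich q S f ≤ (1 - θ * (L ^ 11)⁻¹) • f := by
  have hL0 : 0 < L := by linarith
  have hqq : (1 : A) ≤ L ^ 7 • (q * star q) :=
    (one_le_norm_sq_smul_mul_star hq).trans
      (smul_le_smul_of_nonneg_right hq' (mul_star_self_nonneg q))
  have h1 : f ≤ L ^ 4 • (1 : A) := by
    rwa [CStarAlgebra.norm_le_iff_le_algebraMap f (by positivity) hf,
      Algebra.algebraMap_eq_smul_one] at hfL
  have h2 : f ≤ L ^ 11 • (q * star q) := by
    refine h1.trans ?_
    rw [show L ^ 11 = L ^ 4 * L ^ 7 by ring, mul_smul]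
    exact smul_le_smul_of_nonneg_left hqq (show 0 ≤ L ^ 4 by positivity)
  rw [hF, sub_smul, one_smul, sub_le_sub_iff_left, mul_smul]
  refine smul_le_smul_of_nonneg_left ?_ hθ
  rwa [inv_smul_le_iff_of_pos (show 0 < L ^ 11 by positivity)]

theorem nrm2_sandwich_le (hS : PosPreserving S) (hs : SymmOp φ S) (hL : 1 ≤ L)
    (hq : q * q' = 1) (hq' : ‖q'‖ ^ 2 ≤ L ^ 7) (hθ : 0 ≤ θ) (hθ1 : θ ≤ 1)
    (hf : 0 ≤ f) (hfL : ‖f‖ ≤ L ^ 4) (hf1 : (L ^ 4)⁻¹ • (1 : A) ≤ f)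
    (hF : sandwich q S f = f - θ • (q * star q)) (x : A) :
    nrm2 φ (sandwich q S x) ≤ (1 - θ * (L ^ 11)⁻¹) * nrm2 φ x := by
  have hL0 : 0 < L := by linarith
  have h1 : (L ^ 11)⁻¹ ≤ 1 := inv_le_one_of_one_le₀ (one_le_pow₀ hL)
  exact (hS.sandwich q).nrm2_apply_le (hs.sandwich q)
    (sub_nonneg.2 (mul_le_one₀ hθ1 (by positivity) h1))
    (show 0 < (L ^ 4)⁻¹ by positivity) hf1 (sandwich_apply_le hL hq hq' hθ hf hfL hF) x

theorem nrm2_sandwich_le_of_orthogonal (hs : SymmOp φ S)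
    (hfl : IsFlat φ S c₁ c₂) (hL : 1 ≤ L) (hc₁ : L⁻¹ ≤ c₁)
    (hq : q * q' = 1) (hq' : ‖q'‖ ^ 2 ≤ L ^ 7) (hθ : 0 ≤ θ)
    (hf : 0 ≤ f) (hfL : ‖f‖ ≤ L ^ 4) (hf1 : (L ^ 4)⁻¹ • (1 : A) ≤ f)
    (hF : sandwich q S f = f - θ • (q * star q)) {w : A} (hw : φ.tr (f * w) = 0) :
    nrm2 φ (sandwich q S w) ≤ (1 - (L ^ 31)⁻¹) * nrm2 φ w := by
  have hL0 : 0 < L := by linarith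
  have hfle : f ≤ L ^ 4 • (1 : A) := by
    rwa [CStarAlgebra.norm_le_iff_le_algebraMap f (by positivity) hf,
      Algebra.algebraMap_eq_smul_one] at hfL
  set T := sandwich q S - (((L ^ 23)⁻¹ : ℝ) : ℂ) • rankOne φ f with hT
  have happ : ∀ x, T x = sandwich q S x - (L ^ 23)⁻¹ • φ.tr (f * x) • f := fun x => by
    rw [hT, sub_apply, smul_apply, rankOne_apply, Complex.coe_smul]
  have hTpos : PosPreserving T := by
    intro x hx
    have h0 : 0 ≤ (φ.tr x).re := (φ.state_pos x hx).1
    have h1 : φ.tr (f * x) = ((φ.tr (f * x)).re : ℂ) := by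
      refine Complex.ext rfl ?_
      have h2 : starRingEnd ℂ (φ.tr (f * x)) = φ.tr (f * x) := by
        rw [← φ.tr_star, star_mul, hx.isSelfAdjoint.star_eq, hf.isSelfAdjoint.star_eq, φ.tracial]
      simpa using Complex.conj_eq_iff_im.1 h2
    have h2 : (φ.tr (f * x)).re ≤ L ^ 4 * (φ.tr x).re := by
      have := φ.tr_mul_le hfle hx
      rwa [smul_mul_assoc, one_mul, φ.tr_real_smul_re] at this
    have h3 := φ.tr_mul_nonneg hf hx
    rw [happ, sub_nonneg, h1, Complex.coe_smul, smul_smul]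
    refine le_trans ?_ (hfl.tr_smul_one_le_sandwich hL hc₁ hq hq' hx)
    calc ((L ^ 23)⁻¹ * (φ.tr (f * x)).re) • f
        ≤ ((L ^ 23)⁻¹ * (φ.tr (f * x)).re) • (L ^ 4 • (1 : A)) :=
          smul_le_smul_of_nonneg_left hfle (mul_nonneg (by positivity) h3)
      _ = ((L ^ 23)⁻¹ * (φ.tr (f * x)).re * L ^ 4) • (1 : A) := by rw [smul_smul]
      _ ≤ ((L ^ 15)⁻¹ * (φ.tr x).re) • (1 : A) := by
          refine smul_le_smul_of_nonneg_right ?_ zero_le_one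
          calc (L ^ 23)⁻¹ * (φ.tr (f * x)).re * L ^ 4
              ≤ (L ^ 23)⁻¹ * (L ^ 4 * (φ.tr x).re) * L ^ 4 := by gcongr
            _ = (L ^ 15)⁻¹ * (φ.tr x).re := by field_simp
  have htrf : (L ^ 4)⁻¹ ≤ (φ.tr f).re := by
    have := φ.tr_re_mono hf1
    rwa [φ.tr_real_smul_re, φ.unital, Complex.one_re, mul_one] at this
  have htrff : (L ^ 8)⁻¹ ≤ (φ.tr (f * f)).re := by
    have := φ.tr_mul_le hf1 hf
    rw [smul_mul_assoc, one_mul, φ.tr_real_smul_re] at this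
    refine le_trans ?_ this
    calc (L ^ 8)⁻¹ = (L ^ 4)⁻¹ * (L ^ 4)⁻¹ := by field_simp
      _ ≤ _ := by gcongr
  have hTf : T f ≤ (1 - (L ^ 31)⁻¹) • f := by
    have h1 : φ.tr (f * f) = ((φ.tr (f * f)).re : ℂ) := by
      refine φ.tr_eq_re ?_
      rw [IsSelfAdjoint, star_mul, hf.isSelfAdjoint.star_eq]
    rw [happ, sub_smul, one_smul, h1, Complex.coe_smul, smul_smul]
    refine sub_le_sub ?_ ?_
    · rw [hF, sub_le_self_iff]
      exact smul_nonneg hθ (mul_star_self_nonneg q)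
    · refine smul_le_smul_of_nonneg_right ?_ hf
      calc (L ^ 31)⁻¹ = (L ^ 23)⁻¹ * (L ^ 8)⁻¹ := by field_simp
        _ ≤ _ := by gcongr
  have h1 : (L ^ 31)⁻¹ ≤ 1 := inv_le_one_of_one_le₀ (one_le_pow₀ hL)
  have h2 := hTpos.nrm2_apply_le
    ((hs.sandwich q).sub_real_smul (symmOp_rankOne hf.isSelfAdjoint) _)
    (sub_nonneg.2 h1) (show 0 < (L ^ 4)⁻¹ by positivity) hf1 hTf w
  rwa [happ, hw, zero_smul, smul_zero, sub_zero] at h2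

theorem nrm2_le_nrm2_sub_rotated_sandwich {u : A} {s : ℝ} (hS : PosPreserving S)
    (hs : SymmOp φ S) (hfl : IsFlat φ S c₁ c₂) (hL : 1 ≤ L) (hc₁ : L⁻¹ ≤ c₁)
    (hq : q * q' = 1) (hqL : ‖q‖ ^ 2 ≤ L ^ 7) (hq' : ‖q'‖ ^ 2 ≤ L ^ 7)
    (hθ : 0 ≤ θ) (hθ1 : θ ≤ 1) (hθs : L⁻¹ ≤ θ ∨ L⁻¹ ≤ s)
    (hf : 0 ≤ f) (hfL : ‖f‖ ≤ L ^ 4) (hf1 : (L ^ 4)⁻¹ • (1 : A) ≤ f)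
    (hF : sandwich q S f = f - θ • (q * star q))
    (hu1 : star u * u = 1) (hu2 : u * star u = 1)
    (hfu : f - u * f * u = (-(2 * Complex.I * s)) • (u * (f * f))) (y : A) :
    nrm2 φ y ≤ 1000 * L ^ 79 * nrm2 φ (y - u * sandwich q S y * u) := by
  have hL0 : 0 < L := by linarith
  have hnn := φ.nrm2_nonneg (y - u * sandwich q S y * u)
  have hL79 : L ^ 57 ≤ L ^ 79 := pow_le_pow_right₀ hL (by norm_num)
  have hcontr := nrm2_sandwich_le hS hs hL hq hq' hθ hθ1 hf hfL hf1 hF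
  by_cases hcase : (1000 * L ^ 68)⁻¹ ≤ θ
  · have h1 := φ.nrm2_add_le (y - u * sandwich q S y * u) (u * sandwich q S y * u)
    rw [sub_add_cancel, φ.nrm2_unitary_conj hu1 hu2] at h1
    have h2 := hcontr y
    have h3 : (1000 * L ^ 79)⁻¹ * nrm2 φ y ≤ nrm2 φ (y - u * sandwich q S y * u) := by
      have h4 : (1000 * L ^ 79)⁻¹ ≤ θ * (L ^ 11)⁻¹ := by
        calc (1000 * L ^ 79)⁻¹ = (1000 * L ^ 68)⁻¹ * (L ^ 11)⁻¹ := by field_simp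
          _ ≤ _ := by gcongr
      have h5 := mul_le_mul_of_nonneg_right h4 (φ.nrm2_nonneg y)
      linarith
    rwa [inv_mul_le_iff₀ (by positivity)] at h3
  push Not at hcase
  have hsL : L⁻¹ ≤ s := by
    rcases hθs with h | h
    · exfalso
      have h1 : (1000 * L ^ 68)⁻¹ ≤ L⁻¹ := by
        gcongr
        calc L = 1 * L ^ 1 := by ring
          _ ≤ 1000 * L ^ 68 := by gcongr <;> norm_num [hL]
      linarith
    · exact h
  have htrf : (L ^ 4)⁻¹ ≤ (φ.tr f).re := by
    have := φ.tr_re_mono hf1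
    rwa [φ.tr_real_smul_re, φ.unital, Complex.one_re, mul_one] at this
  have htrff : (L ^ 8)⁻¹ ≤ (φ.tr (f * f)).re := by
    have := φ.tr_mul_le hf1 hf
    rw [smul_mul_assoc, one_mul, φ.tr_real_smul_re] at this
    refine le_trans ?_ this
    calc (L ^ 8)⁻¹ = (L ^ 4)⁻¹ * (L ^ 4)⁻¹ := by field_simp
      _ ≤ _ := by gcongr
  have hfn : (L ^ 4)⁻¹ ≤ nrm2 φ f :=
    htrf.trans ((Complex.re_le_norm _).trans (φ.norm_tr_le f))
  have hfn' : nrm2 φ f ≤ L ^ 4 := (φ.nrm2_le_norm f).trans hfL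
  have hfpos : 0 < nrm2 φ f := lt_of_lt_of_le (by positivity) hfn
  obtain ⟨e, he⟩ : ∃ e : A, e = (nrm2 φ f)⁻¹ • f := ⟨_, rfl⟩
  have hmulu : ∀ x, nrm2 φ (u * x) = nrm2 φ x := fun x => by
    rw [nrm2, nrm2, star_mul, mul_assoc, ← mul_assoc (star u), hu1, one_mul]
  have hinv : 0 ≤ (nrm2 φ f)⁻¹ := inv_nonneg.2 hfpos.le
  have he1 : nrm2 φ e = 1 := by
    rw [he, φ.nrm2_real_smul, abs_of_nonneg hinv, inv_mul_cancel₀ hfpos.ne']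
  have hrot : (L ^ 13)⁻¹ ≤ nrm2 φ (e - u * e * u) := by
    have h1 : e - u * e * u = (nrm2 φ f)⁻¹ • (f - u * f * u) := by
      rw [he, smul_sub, mul_smul_comm, smul_mul_assoc]
    have h2 : (L ^ 8)⁻¹ ≤ nrm2 φ (f * f) :=
      htrff.trans ((Complex.re_le_norm _).trans (φ.norm_tr_le _))
    have hs0 : 0 < s := lt_of_lt_of_le (by positivity) hsL
    rw [h1, hfu, φ.nrm2_real_smul, abs_of_nonneg hinv, φ.nrm2_smul, hmulu, norm_neg, norm_mul,
      norm_mul, Complex.norm_I, Complex.norm_real, Real.norm_of_nonneg hs0.le]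
    norm_num
    have h3 : (L ^ 4)⁻¹ ≤ (nrm2 φ f)⁻¹ := by gcongr
    calc (L ^ 13)⁻¹ = (L ^ 4)⁻¹ * (1 * L⁻¹ * (L ^ 8)⁻¹) := by field_simp
      _ ≤ (nrm2 φ f)⁻¹ * (2 * s * nrm2 φ (f * f)) := by gcongr; norm_num
  have hres : nrm2 φ (sandwich q S e - e) ≤ (L ^ 31)⁻¹ * (L ^ 13)⁻¹ ^ 2 / 1000 := by
    have h1 : sandwich q S e - e = (nrm2 φ f)⁻¹ • ((-θ) • (q * star q)) := by
      rw [he, map_real_smul, ← smul_sub, hF, sub_sub_cancel_left, neg_smul]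
    have h2 : nrm2 φ (q * star q) ≤ L ^ 7 := by
      refine (φ.nrm2_le_norm _).trans ?_
      rwa [CStarRing.norm_self_mul_star, ← sq]
    have h3 : (nrm2 φ f)⁻¹ ≤ L ^ 4 := inv_le_of_inv_le₀ (by positivity) hfn
    rw [h1, φ.nrm2_real_smul, φ.nrm2_real_smul, abs_of_nonneg hinv, abs_neg, abs_of_nonneg hθ]
    have hnq := φ.nrm2_nonneg (q * star q)
    calc (nrm2 φ f)⁻¹ * (θ * nrm2 φ (q * star q))
        ≤ L ^ 4 * ((1000 * L ^ 68)⁻¹ * L ^ 7) := by gcongr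
      _ = (L ^ 31)⁻¹ * (L ^ 13)⁻¹ ^ 2 / 1000 := by field_simp
  have hL11 : 1 - θ * (L ^ 11)⁻¹ ≤ 1 := by
    have : 0 ≤ θ * (L ^ 11)⁻¹ := by positivity
    linarith
  have main := norm_le_of_gap_of_rotation (F := onL2 φ (sandwich q S))
    (hs.sandwich q).isSymmetric_onL2 (f := φ.toL2 e) (δ := (L ^ 31)⁻¹) (σ := (L ^ 13)⁻¹)
    (fun x => by
      obtain ⟨x, rfl⟩ := φ.toL2.surjective x
      rw [onL2_toL2, ← φ.nrm2_eq, ← φ.nrm2_eq]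
      exact (hcontr x).trans (mul_le_of_le_one_left (φ.nrm2_nonneg x) hL11))
    (onL2 φ (ContinuousLinearMap.mulLeftRight ℂ A u u))
    (fun x => by
      obtain ⟨x, rfl⟩ := φ.toL2.surjective x
      rw [onL2_toL2, ← φ.nrm2_eq, ← φ.nrm2_eq, ContinuousLinearMap.mulLeftRight_apply,
        φ.nrm2_unitary_conj hu1 hu2])
    he1 (by positivity) (inv_le_one_of_one_le₀ (one_le_pow₀ hL))
    (fun w => by
      obtain ⟨w, rfl⟩ := φ.toL2.surjective w
      intro hw
      rw [onL2_toL2, ← φ.nrm2_eq, ← φ.nrm2_eq]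
      refine nrm2_sandwich_le_of_orthogonal hs hfl hL hc₁ hq hq' hθ hf hfL hf1 hF ?_
      rw [φ.inner_toL2, he, star_smul, hf.isSelfAdjoint.star_eq, smul_mul_assoc, star_trivial,
        φ.tr_real_smul, mul_eq_zero] at hw
      refine hw.resolve_left ?_
      exact_mod_cast (inv_pos.2 hfpos).ne')
    (by positivity) (inv_le_one_of_one_le₀ (one_le_pow₀ hL))
    (by
      rw [onL2_toL2, ← map_sub, ← φ.nrm2_eq, ContinuousLinearMap.mulLeftRight_apply]
      exact hrot)
    (by
      rw [onL2_toL2, ← map_sub, ← φ.nrm2_eq]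
      exact hres)
    (φ.toL2 y)
  rw [onL2_toL2, onL2_toL2, ← map_sub, ← φ.nrm2_eq, ← φ.nrm2_eq,
    ContinuousLinearMap.mulLeftRight_apply] at main
  refine main.trans ?_
  gcongr
  calc 1000 / ((L ^ 31)⁻¹ * (L ^ 13)⁻¹ ^ 2) = 1000 * L ^ 57 := by field_simp
    _ ≤ 1000 * L ^ 79 := by gcongr

end Core

section Stability

variable {φ : TracialState A} {S : A →L[ℂ] A} {c₁ c₂ L θ s : ℝ} {m n h : A}

theorem stability_of_balanced (hS : PosPreserving S) (hs : SymmOp φ S)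
    (hfl : IsFlat φ S c₁ c₂) (hc₂ : 0 ≤ c₂) (hL : 1 ≤ L) (hc₁ : L⁻¹ ≤ c₁)
    (hθ : 0 < θ) (hθ1 : θ ≤ 1) (hθs : L⁻¹ ≤ θ ∨ L⁻¹ ≤ s)
    (hmn : m * n = -1) (hnm : n * m = -1) (hm : ‖m‖ ≤ L) (hn : ‖n‖ ≤ L)
    (hlow : m * star m ≤ L • h) (hup : h ≤ L • (m * star m)) (him : imA m = s • h)
    (hnh : n * h * star n = S h + θ • 1) :
    (∀ x, nrm2 φ x ≤ 1000 * L ^ 93 * nrm2 φ (x - m * S x * m)) ∧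
      ∀ x, ∃ y, y - m * S y * m = x := by
  obtain ⟨q, q', u, f, f', hq, hq2, hu1, hu2, hmq, hf, hf', hff, hff', hfL, hfL', hqL, hqL', hqf,
    hqn, hfu⟩ := exists_balanced_polar hL hmn hnm hm hn hlow hup him
  have hL0 : 0 < L := by linarith
  have hf1 : (L ^ 4)⁻¹ • (1 : A) ≤ f := inv_smul_one_le_of_inverse (by positivity) hf hff hff' hfL'
  have hF : sandwich q S f = f - θ • (q * star q) := by
    rw [sandwich_apply, hqf]
    nth_rewrite 1 [← hqn]
    have : q * n * h * star n * star q = q * (n * h * star n) * star q := by simp only [mul_assoc]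
    rw [this, hnh, mul_add, add_mul, mul_smul_comm, mul_one, smul_mul_assoc, add_sub_cancel_right]
  have hsq : star q * star q' = 1 := by rw [← star_mul, hq2, star_one]
  have hsq2 : star q' * star q = 1 := by rw [← star_mul, hq, star_one]
  have hsqr : ∀ x : A, star q * (star q' * x) = x := fun x => by rw [← mul_assoc, hsq, one_mul]
  have hsq2r : ∀ x : A, star q' * (star q * x) = x := fun x => by rw [← mul_assoc, hsq2, one_mul]
  have hqr : ∀ x : A, q * (q' * x) = x := fun x => by rw [← mul_assoc, hq, one_mul]
  have hcov : ∀ y : A, star q * y * q - m * S (star q * y * q) * m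
      = star q * (y - u * sandwich q S y * u) * q := fun y => by
    rw [sandwich_apply, hmq]
    simp only [mul_sub, sub_mul, mul_assoc]
  have hback : ∀ x : A, star q * (star q' * x * q') * q = x := fun x => by
    simp only [mul_assoc, hsqr, hq2, mul_one]
  have hback2 : ∀ x : A, star q' * (star q * x * q) * q' = x := fun x => by
    simp only [mul_assoc, hsq2r, hq, mul_one]
  constructor
  · intro x
    obtain ⟨y, rfl⟩ : ∃ y, x = star q * y * q := ⟨_, (hback x).symm⟩
    have h1 := nrm2_le_nrm2_sub_rotated_sandwich hS hs hfl hL hc₁ hq hqL hqL' hθ.le hθ1 hθs hf hfL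
      hf1 hF hu1 hu2 hfu y
    have h2 := φ.nrm2_conj_le (star q) y q
    have h3 := φ.nrm2_conj_le (star q') (star q * (y - u * sandwich q S y * u) * q) q'
    rw [hback2, ← hcov, norm_star, ← sq] at h3
    rw [norm_star, ← sq] at h2
    have hn0 := φ.nrm2_nonneg (star q * y * q - m * S (star q * y * q) * m)
    have hn1 := φ.nrm2_nonneg y
    have hn2 := φ.nrm2_nonneg (y - u * sandwich q S y * u)
    calc nrm2 φ (star q * y * q) ≤ ‖q‖ ^ 2 * nrm2 φ y := h2
      _ ≤ L ^ 7 * (1000 * L ^ 79 * nrm2 φ (y - u * sandwich q S y * u)) := by gcongr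
      _ ≤ L ^ 7 * (1000 * L ^ 79 *
          (L ^ 7 * nrm2 φ (star q * y * q - m * S (star q * y * q) * m))) := by
        gcongr
        exact h3.trans (mul_le_mul_of_nonneg_right hqL' hn0)
      _ = _ := by ring
  · intro x
    have hlt : 1 - θ * (L ^ 11)⁻¹ < 1 := by
      have : 0 < θ * (L ^ 11)⁻¹ := by positivity
      linarith
    have hnonneg : 0 ≤ 1 - θ * (L ^ 11)⁻¹ :=
      sub_nonneg.2 (mul_le_one₀ hθ1 (by positivity) (inv_le_one_of_one_le₀ (one_le_pow₀ hL)))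
    obtain ⟨y, hy⟩ := exists_sub_apply_eq (φ := φ)
      (ContinuousLinearMap.mulLeftRight ℂ A u u ∘L sandwich q S) hnonneg hlt
      (B := ‖u‖ * (‖q‖ * (4 * c₂ * (‖q‖ * ‖q‖)) * ‖q‖) * ‖u‖) (by positivity)
      (fun x => by
        rw [ContinuousLinearMap.comp_apply, ContinuousLinearMap.mulLeftRight_apply,
          φ.nrm2_unitary_conj hu1 hu2]
        exact nrm2_sandwich_le hS hs hL hq hqL' hθ.le hθ1 hf hfL hf1 hF x)
      (fun x => by
        rw [ContinuousLinearMap.comp_apply, ContinuousLinearMap.mulLeftRight_apply, sandwich_apply]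
        refine norm_mul₃_le.trans ?_
        have h1 : ‖q * S (star q * x * q) * star q‖ ≤
            ‖q‖ * (4 * c₂ * (‖q‖ * ‖q‖ * nrm2 φ x)) * ‖q‖ := by
          refine norm_mul₃_le.trans ?_
          rw [norm_star]
          gcongr
          refine (hfl.norm_apply_le hS hc₂ _).trans ?_
          gcongr
          simpa only [norm_star] using φ.nrm2_conj_le (star q) x q
        calc ‖u‖ * ‖q * S (star q * x * q) * star q‖ * ‖u‖
            ≤ ‖u‖ * (‖q‖ * (4 * c₂ * (‖q‖ * ‖q‖ * nrm2 φ x)) * ‖q‖) * ‖u‖ := by gcongr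
          _ = _ := by ring)
      (star q' * x * q')
    refine ⟨star q * y * q, ?_⟩
    rw [hcov, ← hback x, ← hy]
    rfl

theorem stability_of_norm_sq_le (hS : PosPreserving S) (hfl : IsFlat φ S c₁ c₂) (hc₂ : 0 ≤ c₂)
    (hm : 8 * c₂ * ‖m‖ ^ 2 ≤ 1) :
    (∀ x, nrm2 φ x ≤ 2 * nrm2 φ (x - m * S x * m)) ∧ ∀ x, ∃ y, y - m * S y * m = x := by
  have hinf : ∀ x, ‖m * S x * m‖ ≤ 1 / 2 * nrm2 φ x := fun x => by
    calc ‖m * S x * m‖ ≤ ‖m‖ * ‖S x‖ * ‖m‖ := norm_mul₃_le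
      _ ≤ ‖m‖ * (4 * c₂ * nrm2 φ x) * ‖m‖ := by gcongr; exact hfl.norm_apply_le hS hc₂ x
      _ = (8 * c₂ * ‖m‖ ^ 2) / 2 * nrm2 φ x := by ring
      _ ≤ 1 / 2 * nrm2 φ x := by have := φ.nrm2_nonneg x; gcongr
  have h2 : ∀ x, nrm2 φ (m * S x * m) ≤ 1 / 2 * nrm2 φ x := fun x =>
    (φ.nrm2_le_norm _).trans (hinf x)
  refine ⟨fun x => ?_, fun x => ?_⟩
  · have h3 := φ.nrm2_add_le (x - m * S x * m) (m * S x * m)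
    rw [sub_add_cancel] at h3
    linarith [h2 x]
  · exact exists_sub_apply_eq (φ := φ) (ContinuousLinearMap.mulLeftRight ℂ A m m ∘L S)
      (by norm_num) (by norm_num) (by norm_num) h2 hinf x

end Stability

section DysonEquation

theorem imA_mul_mul_star (x y : A) : imA (x * y * star x) = x * imA y * star x := by
  simp only [imA, mul_smul_comm, smul_mul_assoc, star_mul, star_star, mul_sub, sub_mul, mul_assoc]

theorem imA_neg_star (x : A) : imA (-star x) = imA x := by
  simp only [imA, star_neg, star_star]
  congr 1
  abel

theorem norm_imA_le (x : A) : ‖imA x‖ ≤ ‖x‖ := by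
  rw [imA, norm_smul]
  have := norm_sub_le x (star x)
  rw [norm_star] at this
  norm_num
  linarith

theorem imA_spectral {a : A} {S : A →L[ℂ] A} (ha : IsSelfAdjoint a) (hS : PosPreserving S)
    (z : ℂ) (m : A) : imA (z • (1 : A) - a + S m) = z.im • (1 : A) + S (imA m) := by
  have h1 : z • (1 : A) - star z • (1 : A) = (2 * Complex.I) • z.im • (1 : A) := by
    rw [← sub_smul, ← Complex.coe_smul, smul_smul]
    congr 1
    rw [Complex.star_def, Complex.sub_conj]
    push_cast
    ring
  have h2 : (z • (1 : A) - a + S m) - star (z • (1 : A) - a + S m)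
      = (2 * Complex.I) • z.im • (1 : A) + S (m - star m) := by
    rw [← h1, map_sub, hS.map_star]
    simp only [star_add, star_sub, star_smul, star_one, ha.star_eq]
    abel
  have h3 : (2 * Complex.I)⁻¹ * (2 * Complex.I) = 1 := inv_mul_cancel₀ (by simp)
  rw [imA, h2, smul_add, smul_smul, h3, one_smul, ← map_smul, ← imA]

variable {m n : A}

theorem mul_imA_mul_star_of_inverse (hmn : m * n = -1) : m * imA n * star m = imA m := by
  rw [← imA_mul_mul_star, hmn, neg_one_mul, imA_neg_star]

theorem conj_imA_of_inverse (hnm : n * m = -1) : n * imA m * star n = imA n :=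
  mul_imA_mul_star_of_inverse hnm

variable {φ : TracialState A} {S : A →L[ℂ] A} {c₁ c₂ η : ℝ}

theorem IsFlat.imA_bounds (hfl : IsFlat φ S c₁ c₂) (hmn : m * n = -1)
    (hn : imA n = η • (1 : A) + S (imA m)) (hpos : 0 ≤ imA m) :
    (η + c₁ * (φ.tr (imA m)).re) • (m * star m) ≤ imA m ∧
      imA m ≤ (η + c₂ * (φ.tr (imA m)).re) • (m * star m) := by
  obtain ⟨h1, h2⟩ := hfl _ hpos
  rw [Complex.coe_smul] at h1 h2
  have key := mul_imA_mul_star_of_inverse hmn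
  have hc : ∀ c : ℝ, m * ((η + c) • (1 : A)) * star m = (η + c) • (m * star m) := fun c => by
    rw [mul_smul_comm, mul_one, smul_mul_assoc]
  constructor
  · conv_rhs => rw [← key, hn]
    rw [← hc]
    refine star_right_conjugate_le_conjugate ?_ m
    rw [add_smul]
    exact add_le_add_right h1 _
  · conv_lhs => rw [← key, hn]
    rw [← hc]
    refine star_right_conjugate_le_conjugate ?_ m
    rw [add_smul]
    exact add_le_add_right h2 _

end DysonEquation

section Stieltjes

variable {φ : TracialState A}

theorem nonneg_of_tr_conj_nonneg {y : A} (hy : IsSelfAdjoint y)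
    (h : ∀ x : A, 0 ≤ (φ.tr (star x * y * x)).re) : 0 ≤ y := by
  have hn := CFC.negPart_nonneg y
  have hs := hn.isSelfAdjoint.star_eq
  have h1 : star y⁻ * y * y⁻ = -(y⁻ * y⁻ * y⁻) := by
    have h0 : y * y⁻ = -(y⁻ * y⁻) := by
      nth_rewrite 1 [← CFC.posPart_sub_negPart y hy]
      simp [sub_mul]
    rw [mul_assoc, h0, hs, mul_neg, mul_assoc]
  have h3 : 0 ≤ y⁻ * y⁻ * y⁻ := by simpa only [hs] using star_left_conjugate_nonneg hn y⁻
  have h2 := h y⁻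
  rw [h1, map_neg, Complex.neg_re] at h2
  have h4 := φ.state_pos _ h3
  have h5 := φ.faithful _ h3 (Complex.ext (by simpa using le_antisymm (by linarith) h4.1) h4.2)
  have h6 : star (y⁻ * y⁻) * (y⁻ * y⁻) = 0 := by
    rw [star_mul, hs, mul_assoc, ← mul_assoc (y⁻) (y⁻) (y⁻), h5, mul_zero]
  have h7 : star y⁻ * y⁻ = 0 := by
    rw [hs]; exact (CStarRing.star_mul_self_eq_zero_iff _).1 h6
  have h8 := (CStarRing.star_mul_self_eq_zero_iff _).1 h7
  rw [← CFC.posPart_sub_negPart y hy, h8, sub_zero]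
  exact CFC.posPart_nonneg y

variable {v : OpMeasure A φ}

theorem OpMeasure.scalar_null {B : Set ℝ} (hB : MeasurableSet B) (h : v.dos B = 0) (x : A) :
    v.scalar x B = 0 := by
  have h1 := v.compat 1 B hB
  rw [show v.scalar 1 B = 0 from h] at h1
  simp only [star_one, one_mul, mul_one, ENNReal.toReal_zero, Complex.ofReal_zero] at h1
  have h2 := v.compat x B hB
  rw [φ.faithful _ (v.nonneg B) h1, mul_zero, zero_mul, map_zero] at h2
  have := v.scalarFin x
  have h3 : ((v.scalar x) B).toReal = 0 := by exact_mod_cast h2.symm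
  exact (ENNReal.toReal_eq_zero_iff _).1 h3 |>.resolve_right (measure_ne_top _ _)

theorem OpMeasure.ae_mem_measSupp (v : OpMeasure A φ) (x : A) :
    ∀ᵐ t ∂(v.scalar x), t ∈ measSupp v.dos := by
  refine measure_null_of_locally_null _ fun t ht => ?_
  have ht' : ¬ ∀ ε : ℝ, 0 < ε → v.dos (Set.Ioo (t - ε) (t + ε)) ≠ 0 := ht
  push Not at ht'
  obtain ⟨ε, hε, h0⟩ := ht'
  exact ⟨_, mem_nhdsWithin_of_mem_nhds (Ioo_mem_nhds (by linarith) (by linarith)),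
    v.scalar_null measurableSet_Ioo h0 x⟩

theorem StieltjesRep.imA_le {m : ℂ → A} (hm : StieltjesRep φ v m) (hv : v.val Set.univ = 1)
    {z : ℂ} (hz : 0 < z.im) {d : ℝ} (hd : 0 < d)
    (hdist : ∀ t ∈ measSupp v.dos, d ≤ ‖(t : ℂ) - z‖) :
    imA (m z) ≤ (z.im / d ^ 2) • (1 : A) := by
  rw [← sub_nonneg]
  refine nonneg_of_tr_conj_nonneg (φ := φ)
    (((IsSelfAdjoint.all _).smul (IsSelfAdjoint.one A)).sub (isSelfAdjoint_imA _)) fun x => ?_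
  have := v.scalarFin x
  have him : (φ.tr (star x * imA (m z) * x)).re = (φ.tr (star x * m z * x)).im := by
    have h1 : star x * imA (m z) * x = imA (star x * m z * x) := by
      simpa only [star_star] using (imA_mul_mul_star (star x) (m z)).symm
    rw [h1, imA, map_smul, map_sub, φ.tr_star, Complex.sub_conj, smul_eq_mul]
    have h2 : (2 * Complex.I)⁻¹ * (((2 * (φ.tr (star x * m z * x)).im : ℝ) : ℂ) * Complex.I)
        = (((φ.tr (star x * m z * x)).im : ℝ) : ℂ) := by
      push_cast
      field_simp
    rw [h2, Complex.ofReal_re]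
  have hne : ∀ t : ℝ, (t : ℂ) - z ≠ 0 := fun t h => by
    have := congrArg Complex.im h
    simp at this
    exact hz.ne' this
  have hbd : ∀ t : ℝ, ‖((t : ℂ) - z)⁻¹‖ ≤ z.im⁻¹ := fun t => by
    rw [norm_inv]
    gcongr
    have := Complex.abs_im_le_norm ((t : ℂ) - z)
    simpa [abs_of_pos hz] using this
  have hint : Integrable (fun t : ℝ => ((t : ℂ) - z)⁻¹) (v.scalar x) := by
    refine Integrable.of_bound (Continuous.aestronglyMeasurable ?_) z.im⁻¹
      (Filter.Eventually.of_forall hbd)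
    exact Continuous.inv₀ (by fun_prop) hne
  have htot : (φ.tr (star x * x)).re = ((v.scalar x) Set.univ).toReal := by
    have := v.compat x Set.univ MeasurableSet.univ
    rw [hv, mul_one] at this
    rw [this, Complex.ofReal_re]
  have hptw : ∀ᵐ t : ℝ ∂(v.scalar x), (((t : ℂ) - z)⁻¹).im ≤ z.im / d ^ 2 := by
    filter_upwards [v.ae_mem_measSupp x] with t ht
    have h1 := hdist t ht
    rw [Complex.inv_im, Complex.normSq_eq_norm_sq]
    simp only [Complex.sub_im, Complex.ofReal_im, zero_sub, neg_neg]
    gcongr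
  have hle : (φ.tr (star x * imA (m z) * x)).re ≤ z.im / d ^ 2 * (φ.tr (star x * x)).re := by
    rw [him, hm z hz x, htot]
    have h1 : (∫ t : ℝ, ((t : ℂ) - z)⁻¹ ∂(v.scalar x)).im
        = ∫ t : ℝ, (((t : ℂ) - z)⁻¹).im ∂(v.scalar x) := (integral_im hint).symm
    rw [h1]
    calc ∫ t : ℝ, (((t : ℂ) - z)⁻¹).im ∂(v.scalar x)
        ≤ ∫ _ : ℝ, z.im / d ^ 2 ∂(v.scalar x) :=
          integral_mono_ae hint.im (integrable_const _) hptw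
      _ = z.im / d ^ 2 * ((v.scalar x) Set.univ).toReal := by
          rw [integral_const, smul_eq_mul, mul_comm]
          rfl
  rw [mul_sub, sub_mul, map_sub, Complex.sub_re, mul_smul_comm, mul_one, smul_mul_assoc,
    φ.tr_real_smul_re]
  linarith

end Stieltjes

section Bounds

variable {φ : TracialState A} {S : A →L[ℂ] A} {a m : A} {c₁ c₂ c₃ : ℝ} {z : ℂ}

theorem norm_le_of_smul_mul_star_le {h : A} {c D : ℝ} (hc : 0 < c) (hle : c • (m * star m) ≤ h)
    (hD : ‖h‖ ≤ D) : c * ‖m‖ ^ 2 ≤ D := by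
  have := CStarAlgebra.norm_le_norm_of_nonneg_of_le
    (smul_nonneg hc.le (mul_star_self_nonneg m)) hle
  rw [norm_smul, CStarRing.norm_self_mul_star, Real.norm_of_nonneg hc.le, ← sq] at this
  exact this.trans hD

theorem nrm2_le_of_smul_mul_star_le (hc₁ : 0 < c₁) (hr : 0 < (φ.tr (imA m)).re)
    (hle : (c₁ * (φ.tr (imA m)).re) • (m * star m) ≤ imA m) : nrm2 φ m ≤ 1 + c₁⁻¹ := by
  have h1 := φ.tr_re_mono hle
  rw [φ.tr_real_smul_re, φ.tracial, ← φ.nrm2_sq] at h1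
  have h2 : c₁ * nrm2 φ m ^ 2 ≤ 1 := by
    have : (c₁ * nrm2 φ m ^ 2) * (φ.tr (imA m)).re ≤ 1 * (φ.tr (imA m)).re := by linarith
    exact le_of_mul_le_mul_right this hr
  have h3 : nrm2 φ m ^ 2 ≤ c₁⁻¹ := by rwa [← one_div, le_div_iff₀' hc₁]
  nlinarith [sq_nonneg (nrm2 φ m - 1), φ.nrm2_nonneg m]

theorem norm_mul_sub_le_one (φ : TracialState A) {b : ℝ} (ha : ‖a‖ ≤ c₃) (hb : ‖S m‖ ≤ b)
    (hmn : m * (z • (1 : A) - a + S m) = -1) : (‖z‖ - c₃ - b) * ‖m‖ ≤ 1 := by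
  have := φ.nontrivial
  have h1 : z • m = m * a - m * S m - 1 := by
    have : m * (z • (1 : A) - a + S m) = z • m - m * a + m * S m := by
      rw [mul_add, mul_sub, mul_smul_comm, mul_one]
    rw [this] at hmn
    rw [sub_eq_add_neg _ (1 : A), ← hmn]
    abel
  have h2 : ‖z‖ * ‖m‖ ≤ ‖m‖ * c₃ + ‖m‖ * b + 1 := by
    rw [← norm_smul, h1]
    calc ‖m * a - m * S m - 1‖ ≤ ‖m * a‖ + ‖m * S m‖ + ‖(1 : A)‖ :=
          (norm_sub_le _ _).trans (add_le_add_left (norm_sub_le _ _) _)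
      _ ≤ ‖m‖ * ‖a‖ + ‖m‖ * ‖S m‖ + 1 := by
          rw [CStarRing.norm_one]; gcongr <;> exact norm_mul_le _ _
      _ ≤ _ := by gcongr
  linarith

theorem norm_spectral_le (φ : TracialState A) {b : ℝ} (ha : ‖a‖ ≤ c₃) (hb : ‖S m‖ ≤ b) :
    ‖z • (1 : A) - a + S m‖ ≤ ‖z‖ + c₃ + b := by
  have := φ.nontrivial
  have h1 := norm_add_le (z • (1 : A) - a) (S m)
  have h2 := norm_sub_le (z • (1 : A)) a
  rw [norm_smul, CStarRing.norm_one, mul_one] at h2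
  linarith

/-- The stability bound in terms of `L`, once `m`, its inverse and either the relative size of
`Im z` or the size of `Im m` are controlled by `L`. -/
theorem stability_of_bounds (hS : PosPreserving S) (hs : SymmOp φ S) (hfl : IsFlat φ S c₁ c₂)
    (hc₂ : 0 ≤ c₂) {L : ℝ} {n : A} {η : ℝ} (hη : 0 < η) (hL : 1 ≤ L) (hc₁ : L⁻¹ ≤ c₁)
    (hc₂L : c₂ ≤ L) (hmn : m * n = -1) (hnm : n * m = -1) (hm : ‖m‖ ≤ L) (hn : ‖n‖ ≤ L)
    (hpos : 0 ≤ imA m) (himn : imA n = η • (1 : A) + S (imA m))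
    (hcase : η + (φ.tr (imA m)).re ≤ L * η ∨ L⁻¹ ≤ (φ.tr (imA m)).re) :
    (∀ x, nrm2 φ x ≤ 1000 * L ^ 93 * nrm2 φ (x - m * S x * m)) ∧
      ∀ x, ∃ y, y - m * S y * m = x := by
  have hL0 : 0 < L := by linarith
  obtain ⟨r, hr⟩ : ∃ r, r = (φ.tr (imA m)).re := ⟨_, rfl⟩
  obtain ⟨hlow, hup⟩ := hfl.imA_bounds hmn himn hpos
  have hr0 : 0 ≤ r := hr ▸ (φ.state_pos _ hpos).1
  rw [← hr] at hlow hup hcase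
  have hs0 : 0 < η + r := by linarith
  have hs0' : 0 ≤ (η + r)⁻¹ := inv_nonneg.2 hs0.le
  have hL1 : L⁻¹ ≤ 1 := inv_le_one_of_one_le₀ hL
  have hmm := mul_star_self_nonneg m
  refine stability_of_balanced (s := η + r) (θ := η / (η + r)) (n := n)
    (h := (η + r)⁻¹ • imA m) hS hs hfl hc₂ hL hc₁ (by positivity)
    ((div_le_one hs0).2 (by linarith)) ?_ hmn hnm hm hn ?_ ?_ ?_ ?_
  · rcases hcase with h | h
    · left
      rwa [le_div_iff₀ hs0, inv_mul_le_iff₀ hL0]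
    · right
      linarith
  · rw [smul_smul, ← inv_smul_le_iff_of_pos (show 0 < L * (η + r)⁻¹ by positivity)]
    refine le_trans (smul_le_smul_of_nonneg_right ?_ hmm) hlow
    rw [mul_inv, inv_inv, mul_add]
    have h1 := mul_le_mul_of_nonneg_right hc₁ hr0
    have h2 := mul_le_mul_of_nonneg_right hL1 hη.le
    linarith
  · rw [inv_smul_le_iff_of_pos hs0, smul_smul]
    refine hup.trans (smul_le_smul_of_nonneg_right ?_ hmm)
    nlinarith
  · rw [smul_smul, mul_inv_cancel₀ hs0.ne', one_smul]
  · rw [mul_smul_comm, smul_mul_assoc, conj_imA_of_inverse hnm, himn, smul_add, map_real_smul,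
      smul_smul, add_comm]
    congr 2
    rw [div_eq_inv_mul]

theorem inverse_bound_numeric {K₀ d : ℝ} (hK : 0 ≤ K₀) (hd : 0 < d) :
    1000 * (K₀ * (1 + d⁻¹) ^ 2) ^ 93 ≤
      (1000 * K₀ ^ 93 * 2 ^ 186 + 2) * (1 + d ^ (-186 : ℝ)) := by
  have h1 : d ^ (-186 : ℝ) = d⁻¹ ^ 186 := by
    rw [Real.rpow_neg hd.le, ← Real.inv_rpow hd.le, ← Real.rpow_natCast]
    norm_num
  have h2 : (1 + d⁻¹) ^ 186 ≤ 2 ^ 186 * (1 + d⁻¹ ^ 186) := by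
    refine (add_pow_le zero_le_one (inv_nonneg.2 hd.le) 186).trans ?_
    rw [one_pow]
    gcongr <;> norm_num
  have h3 : 0 ≤ d⁻¹ ^ 186 := pow_nonneg (inv_nonneg.2 hd.le) _
  have h4 : ((1 + d⁻¹) ^ 2) ^ 93 = (1 + d⁻¹) ^ 186 := by rw [← pow_mul]
  rw [h1, mul_pow, h4, ← mul_assoc]
  have h5 : 0 ≤ 1000 * K₀ ^ 93 := mul_nonneg (by norm_num) (pow_nonneg hK _)
  refine (mul_le_mul_of_nonneg_left h2 h5).trans ?_
  rw [← mul_assoc]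
  exact mul_le_mul_of_nonneg_right (le_add_of_nonneg_right zero_le_two)
    (add_nonneg zero_le_one h3)

end Bounds

end Dyson

open Dyson in
/-- **Proposition (linear stability).** There is a universal exponent `C > 0` such that
for every flat data pair (with its model parameters `c₁, c₂, c₃`) the stability operator
`Id − C_{m(z)}S`, `C_m[x] = m x m`, is invertible and its inverse satisfies the
`L²`-bound `‖(Id − C_{m(z)}S)⁻¹‖₂ ≲ 1 + (ρ(z) + dist(z, supp ρ))^{−C}` uniformly on `ℍ`. -/
theorem linear_stability
    {A : Type*} [CStarAlgebra A] [PartialOrder A] [StarOrderedRing A]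
    (φ : TracialState A) :
    ∃ C : ℝ, 0 < C ∧
      ∀ c₁ c₂ c₃ : ℝ, 0 < c₁ → c₁ ≤ c₂ → 0 < c₃ →
        ∃ K : ℝ, 0 < K ∧
          ∀ (a : A) (S : A →L[ℂ] A) (m : ℂ → A) (v : OpMeasure A φ),
            IsSelfAdjoint a → ‖a‖ ≤ c₃ →
            PosPreserving S → SymmOp φ S → IsFlat φ S c₁ c₂ →
            IsDysonSolution a S m →
            v.val Set.univ = 1 → StieltjesRep φ v m →
            ∀ z : ℂ, 0 < z.im →
              ∃ R : A → A,
                (∀ x : A, R (x - m z * S x * m z) = x) ∧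
                (∀ x : A, R x - m z * S (R x) * m z = x) ∧
                (∀ x : A, nrm2 φ (R x) ≤
                  K * (1 + (rhoH φ m z +
                    Metric.infDist z (Complex.ofReal '' measSupp v.dos)) ^ (-C))
                    * nrm2 φ x) := by
  refine ⟨186, by norm_num, fun c₁ c₂ c₃ hc₁ hc₁₂ hc₃ => ?_⟩
  have hc₂ : 0 < c₂ := hc₁.trans_le hc₁₂
  obtain ⟨b, hbdef⟩ : ∃ b, b = 4 * c₂ * (1 + c₁⁻¹) := ⟨_, rfl⟩
  obtain ⟨Z, hZ⟩ : ∃ Z, Z = c₃ + b + 8 * c₂ + 1 := ⟨_, rfl⟩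
  obtain ⟨K₀, hK₀⟩ : ∃ K₀, K₀ = 4 + 2 * c₁⁻¹ + c₂ + (Z + c₃ + b) := ⟨_, rfl⟩
  have hb0 : 0 < b := by rw [hbdef]; positivity
  have hc₁i : 0 < c₁⁻¹ := inv_pos.2 hc₁
  have hK0 : 4 ≤ K₀ := by linarith
  have hK₀0 : 0 ≤ K₀ := by linarith
  refine ⟨1000 * K₀ ^ 93 * 2 ^ 186 + 2, by positivity, ?_⟩
  intro a S m v ha hac hS hs hfl hsol hv hrep z hz
  obtain ⟨⟨ε, hε, hεm⟩, hmn, hnm⟩ := hsol z hz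
  rw [Complex.coe_smul] at hεm
  have hpos : 0 ≤ imA (m z) := (smul_nonneg hε.le zero_le_one).trans hεm
  have hr : 0 < (φ.tr (imA (m z))).re := by
    have := φ.tr_re_mono hεm
    rw [φ.tr_real_smul_re, φ.unital, Complex.one_re, mul_one] at this
    linarith
  have himn := imA_spectral ha hS z (m z)
  obtain ⟨hlow, -⟩ := hfl.imA_bounds hmn himn hpos
  obtain ⟨r, hrdef⟩ : ∃ r, r = (φ.tr (imA (m z))).re := ⟨_, rfl⟩
  obtain ⟨D, hD⟩ : ∃ D, D = Metric.infDist z (Complex.ofReal '' measSupp v.dos) := ⟨_, rfl⟩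
  have hD0 : 0 ≤ D := hD ▸ Metric.infDist_nonneg
  have hmm := mul_star_self_nonneg (m z)
  have hlow1 : (c₁ * (φ.tr (imA (m z))).re) • (m z * star (m z)) ≤ imA (m z) :=
    le_trans (smul_le_smul_of_nonneg_right (by linarith) hmm) hlow
  have hlow2 : z.im • (m z * star (m z)) ≤ imA (m z) :=
    le_trans (smul_le_smul_of_nonneg_right
      (le_add_of_nonneg_right (mul_nonneg hc₁.le hr.le)) hmm) hlow
  have hb : ‖S (m z)‖ ≤ b := by
    refine (hfl.norm_apply_le hS hc₂.le _).trans ?_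
    rw [hbdef]
    gcongr
    exact nrm2_le_of_smul_mul_star_le hc₁ hr hlow1
  rw [← hD, rhoH, ← hrdef]
  rw [← hrdef] at hr hlow1
  have hd0 : 0 < r / Real.pi + D := add_pos_of_pos_of_nonneg (div_pos hr Real.pi_pos) hD0
  obtain ⟨d, hd⟩ : ∃ d, d = r / Real.pi + D := ⟨_, rfl⟩
  rw [← hd]
  rw [← hd] at hd0
  have ht0 : 0 < d⁻¹ := inv_pos.2 hd0
  have key : (∀ x, nrm2 φ x ≤ (1000 * K₀ ^ 93 * 2 ^ 186 + 2) * (1 + d ^ (-186 : ℝ)) *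
      nrm2 φ (x - m z * S x * m z)) ∧ ∀ x, ∃ y, y - m z * S y * m z = x := by
    rcases le_total Z ‖z‖ with hzZ | hzZ
    · have h1 := norm_mul_sub_le_one φ hac hb hmn
      have h2 : (8 * c₂ + 1) * ‖m z‖ ≤ 1 := by
        refine le_trans (mul_le_mul_of_nonneg_right ?_ (norm_nonneg _)) h1
        linarith
      have h3 : ‖m z‖ ≤ 1 := by nlinarith [norm_nonneg (m z)]
      obtain ⟨h4, h5⟩ := stability_of_norm_sq_le (φ := φ) (m := m z) hS hfl hc₂.le (by
        nlinarith [norm_nonneg (m z), mul_nonneg hc₂.le (norm_nonneg (m z))])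
      refine ⟨fun x => (h4 x).trans (mul_le_mul_of_nonneg_right ?_ (φ.nrm2_nonneg _)), h5⟩
      have h6 : 0 ≤ d ^ (-186 : ℝ) := Real.rpow_nonneg hd0.le _
      have h7 : 0 ≤ 1000 * K₀ ^ 93 * 2 ^ 186 := by positivity
      nlinarith [mul_nonneg h7 h6]
    · have hKL : ∀ c, c ≤ K₀ → c ≤ K₀ * (1 + d⁻¹) ^ 2 := fun c hc =>
        hc.trans (le_mul_of_one_le_right hK₀0 (one_le_pow₀ (by linarith)))
      have hKt : ∀ c, 0 ≤ c → c ≤ K₀ → c * d⁻¹ ≤ K₀ * (1 + d⁻¹) ^ 2 := fun c hc0 hc =>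
        mul_le_mul hc (by nlinarith) ht0.le hK₀0
      have hinvd : d * d⁻¹ = 1 := mul_inv_cancel₀ hd0.ne'
      have hL1 : 1 ≤ K₀ * (1 + d⁻¹) ^ 2 := hKL 1 (by linarith)
      have hLc : (K₀ * (1 + d⁻¹) ^ 2)⁻¹ ≤ c₁ :=
        inv_le_of_inv_le₀ hc₁ (hKL _ (by linarith))
      have hcases : ‖m z‖ ≤ K₀ * (1 + d⁻¹) ^ 2 ∧
          (z.im + r ≤ K₀ * (1 + d⁻¹) ^ 2 * z.im ∨ (K₀ * (1 + d⁻¹) ^ 2)⁻¹ ≤ r) := by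
        rcases le_total D (r / Real.pi) with hρ | hρ
        · have h1 : d ≤ 2 * r := by
            have : r / Real.pi ≤ r := div_le_self hr.le (by linarith [Real.two_le_pi])
            linarith
          have h2 : r⁻¹ ≤ 2 * d⁻¹ := by
            rw [inv_le_comm₀ hr (by positivity), mul_inv, inv_inv]
            linarith
          have h3 : c₁ * r * ‖m z‖ ≤ 1 := by
            have := norm_le_of_smul_mul_star_le (mul_pos hc₁ hr) hlow1 (norm_imA_le _)
            rcases (norm_nonneg (m z)).eq_or_lt with h0 | h0
            · rw [← h0]; norm_num
            · exact le_of_mul_le_mul_right (by linarith) h0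
          have h4 : ‖m z‖ ≤ c₁⁻¹ * r⁻¹ := by
            rw [← mul_inv, ← one_div, le_div_iff₀' (by positivity)]
            exact h3
          refine ⟨?_, Or.inr ?_⟩
          · calc ‖m z‖ ≤ c₁⁻¹ * r⁻¹ := h4
              _ ≤ c₁⁻¹ * (2 * d⁻¹) := by gcongr
              _ = 2 * c₁⁻¹ * d⁻¹ := by ring
              _ ≤ _ := hKt _ (by positivity) (by linarith)
          · exact inv_le_of_inv_le₀ hr (h2.trans (hKt 2 (by norm_num) (by linarith)))
        · have hDd : d ≤ 2 * D := by linarith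
          have hDpos : 0 < D := by linarith
          have hDinv : D⁻¹ ≤ 2 * d⁻¹ := by
            rw [inv_le_comm₀ hDpos (by positivity), mul_inv, inv_inv]
            linarith
          have h1 : imA (m z) ≤ (z.im / D ^ 2) • (1 : A) :=
            hrep.imA_le hv hz hDpos fun t ht => by
              rw [hD, ← dist_eq_norm, dist_comm]
              exact Metric.infDist_le_dist_of_mem ⟨t, ht, rfl⟩
          have h2 : ‖m z‖ ≤ D⁻¹ := by
            have h3 := norm_le_of_smul_mul_star_le hz hlow2
              (norm_le_of_le_smul_one hpos h1 (by positivity))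
            have h4 : ‖m z‖ ^ 2 ≤ D⁻¹ ^ 2 := by
              refine le_of_mul_le_mul_left (h3.trans (le_of_eq ?_)) hz
              rw [inv_pow, div_eq_mul_inv]
            exact (pow_le_pow_iff_left₀ (norm_nonneg _) (by positivity) two_ne_zero).1 h4
          refine ⟨(h2.trans hDinv).trans (hKt 2 (by norm_num) (by linarith)), Or.inl ?_⟩
          have h3 := φ.tr_re_mono h1
          rw [φ.tr_real_smul_re, φ.unital, Complex.one_re, mul_one, ← hrdef] at h3
          have h4 : 1 + D⁻¹ ^ 2 ≤ K₀ * (1 + d⁻¹) ^ 2 := by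
            calc 1 + D⁻¹ ^ 2 ≤ 1 + (2 * d⁻¹) ^ 2 := by gcongr
              _ ≤ 4 * (1 + d⁻¹) ^ 2 := by nlinarith
              _ ≤ _ := by gcongr
          calc z.im + r ≤ z.im + z.im / D ^ 2 := by linarith
            _ = (1 + D⁻¹ ^ 2) * z.im := by rw [inv_pow]; ring
            _ ≤ _ := by gcongr
      have hn : ‖z • (1 : A) - a + S (m z)‖ ≤ K₀ * (1 + d⁻¹) ^ 2 :=
        (norm_spectral_le φ hac hb).trans (hKL _ (by linarith))
      obtain ⟨h1, h2⟩ := stability_of_bounds hS hs hfl hc₂.le hz hL1 hLc (hKL _ (by linarith))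
        hmn hnm hcases.1 hn hpos himn (hrdef ▸ hcases.2)
      exact ⟨fun x => (h1 x).trans (mul_le_mul_of_nonneg_right
        (inverse_bound_numeric hK₀0 hd0) (φ.nrm2_nonneg _)), h2⟩
  obtain ⟨hbound, hsurj⟩ := key
  choose R hR using hsurj
  have hinj : ∀ x y : A, x - m z * S x * m z = y - m z * S y * m z → x = y := by
    intro x y hxy
    have h1 := hbound (x - y)
    have h2 : x - y - m z * S (x - y) * m z = 0 := by
      rw [map_sub, mul_sub, sub_mul, sub_sub_sub_comm, hxy, sub_self]
    have h3 : nrm2 φ (0 : A) = 0 := by simp [nrm2]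
    rw [h2, h3, mul_zero] at h1
    exact sub_eq_zero.1 (φ.eq_zero_of_nrm2 (le_antisymm h1 (φ.nrm2_nonneg _)))
  refine ⟨R, fun x => hinj _ _ (hR _), hR, fun x => ?_⟩
  have := hbound (R x)
  rwa [hR] at this
end
end

section
/- Properties of Ψ_min and Ψ_edge: (i) For all λ ∈ ℝ, Ψ_min(λ) = (1/√3)·Im[Ω̂(λ) − Ω̂(0)], where Ω̂(λ) := Φ_odd(λ) + i√3·Φ_even(λ) and Φ_odd, Φ_even are the odd and even parts of the function Φ(ζ) := (√(1+ζ²) + ζ)^{1/3}. (ii) For all λ ≥ 0, Ψ_edge(λ) = (1/(2√3))·Im Ω̂₊(1 + 2λ). (iii) There is a function Ψ̃ : [0,∞) → ℝ with uniformly bounded derivatives and Ψ̃(0) = 0 such that, for all λ ≥ 0, Ψ_edge(λ) = (λ^{1/2}/3)·(1 + Ψ̃(λ)) and |Ψ̃(λ)| ≤ C·min{λ, λ^{1/3}} for a universal constant C. (iv) There is a universal ε* > 0 such that for all |ε| ≤ ε* and all λ ≥ 0, |Ψ_edge((1+ε)λ) − (1+ε)^{1/2}·Ψ_edge(λ)|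 ≤ C·|ε|·min{λ^{3/2}, λ^{1/3}} for a universal constant C. -/
noncomputable section

/-- The universal edge shape function `Ψ_edge`. -/
def psiEdge (l : ℝ) : ℝ :=
  Real.sqrt ((1 + l) * l) /
    ((1 + 2 * l + 2 * Real.sqrt ((1 + l) * l)) ^ ((2 : ℝ)/3)
      + (1 + 2 * l - 2 * Real.sqrt ((1 + l) * l)) ^ ((2 : ℝ)/3) + 1)

/-- The universal internal-minimum shape function `Ψ_min`. -/
def psiMin (l : ℝ) : ℝ :=
  Real.sqrt (1 + l ^ 2) /
    ((Real.sqrt (1 + l ^ 2) + l) ^ ((2 : ℝ)/3)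
      + (Real.sqrt (1 + l ^ 2) - l) ^ ((2 : ℝ)/3) - 1) - 1

/-- `Φ(ζ) = (√(1+ζ²) + ζ)^{1/3}` (complex powers via the principal branch). -/
def PhiFn (ζ : ℂ) : ℂ := ((1 + ζ ^ 2) ^ ((1 : ℂ)/2) + ζ) ^ ((1 : ℂ)/3)

/-- The odd part of `Φ`. -/
def PhiOdd (ζ : ℂ) : ℂ := (PhiFn ζ - PhiFn (-ζ)) / 2

/-- The even part of `Φ`. -/
def PhiEven (ζ : ℂ) : ℂ := (PhiFn ζ + PhiFn (-ζ)) / 2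

/-- `Ω̂(ζ) := Φ_odd(ζ) + i√3·Φ_even(ζ)`. -/
def OmHatMin (ζ : ℂ) : ℂ :=
  PhiOdd ζ + Complex.I * (Real.sqrt 3 : ℂ) * PhiEven ζ

/-- Cardano branch `Φ₊`. -/
def PhiP (ζ : ℂ) : ℂ :=
  if 1 ≤ ζ.re then (ζ + (ζ ^ 2 - 1) ^ ((1 : ℂ)/2)) ^ ((1 : ℂ)/3)
  else if ζ.re ≤ -1 then -((-ζ - (ζ ^ 2 - 1) ^ ((1 : ℂ)/2)) ^ ((1 : ℂ)/3))
  else (ζ + Complex.I * (1 - ζ ^ 2) ^ ((1 : ℂ)/2)) ^ ((1 : ℂ)/3)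

/-- Cardano branch `Φ₋`. -/
def PhiM (ζ : ℂ) : ℂ :=
  if 1 ≤ ζ.re then (ζ - (ζ ^ 2 - 1) ^ ((1 : ℂ)/2)) ^ ((1 : ℂ)/3)
  else if ζ.re ≤ -1 then -((-ζ + (ζ ^ 2 - 1) ^ ((1 : ℂ)/2)) ^ ((1 : ℂ)/3))
  else (ζ - Complex.I * (1 - ζ ^ 2) ^ ((1 : ℂ)/2)) ^ ((1 : ℂ)/3)

/-- The Cardano root `Ω̂₊(ζ) = (Φ₊+Φ₋)/2 + (i√3/2)(Φ₊−Φ₋)` of `Ω³ − 3Ω + 2ζ`. -/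
def OmHatP (ζ : ℂ) : ℂ :=
  (PhiP ζ + PhiM ζ) / 2 + Complex.I * (Real.sqrt 3 : ℂ) / 2 * (PhiP ζ - PhiM ζ)

/-- The cubic parametrisation `l = w(3+4w)²` maps `(-1/4, ∞)` onto `(-1, ∞)`. -/
theorem exists_cubic_eq {l : ℝ} (hl : -1 < l) :
    ∃ w : ℝ, -1 / 4 < w ∧ w * (3 + 4 * w) ^ 2 = l := by
  have hc : ContinuousOn (fun w : ℝ => w * (3 + 4 * w) ^ 2) (Set.Icc (-1 / 4) (l + 1)) := by
    fun_prop
  have hle : (-1 / 4 : ℝ) ≤ l + 1 := by linarith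
  have hmem : l ∈ Set.Icc ((-1 / 4 : ℝ) * (3 + 4 * (-1 / 4)) ^ 2)
      ((l + 1) * (3 + 4 * (l + 1)) ^ 2) := by
    constructor
    · norm_num; linarith
    · have : 0 < l + 1 := by linarith
      nlinarith [pow_pos this 2, pow_pos this 3]
  obtain ⟨w, hw, hwl⟩ := intermediate_value_Icc hle hc hmem
  refine ⟨w, lt_of_le_of_ne hw.1 ?_, hwl⟩
  rintro rfl
  norm_num at hwl
  linarith

/-- The inverse of `w ↦ w(3+4w)²` on `(-1, ∞)`, extended by zero. -/
def cubicInv (l : ℝ) : ℝ :=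
  if h : -1 < l then (exists_cubic_eq h).choose else 0

theorem cubicInv_gt (l : ℝ) : -1 / 4 < cubicInv l := by
  unfold cubicInv
  split_ifs with h
  · exact (exists_cubic_eq h).choose_spec.1
  · norm_num

theorem cubicInv_eq {l : ℝ} (hl : -1 < l) : cubicInv l * (3 + 4 * cubicInv l) ^ 2 = l := by
  unfold cubicInv
  rw [dif_pos hl]
  exact (exists_cubic_eq hl).choose_spec.2

theorem cubic_strictMonoOn :
    StrictMonoOn (fun w : ℝ => w * (3 + 4 * w) ^ 2) (Set.Ioi (-1 / 4)) := by
  intro x hx y hy hxy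
  have hx' : 0 < x + 1 / 4 := by have : -1 / 4 < x := hx; linarith
  have hy' : 0 < y + 1 / 4 := by linarith
  have key : y * (3 + 4 * y) ^ 2 - x * (3 + 4 * x) ^ 2 = (y - x) *
      (16 * ((x + 1 / 4) ^ 2 + (x + 1 / 4) * (y + 1 / 4) + (y + 1 / 4) ^ 2)
        + 12 * ((x + 1 / 4) + (y + 1 / 4))) := by ring
  have : 0 < y * (3 + 4 * y) ^ 2 - x * (3 + 4 * x) ^ 2 := by
    rw [key]
    exact mul_pos (by linarith) (by positivity)
  simpa using this

theorem cubicInv_cubic {w : ℝ} (hw : -1 / 4 < w) : cubicInv (w * (3 + 4 * w) ^ 2) = w := by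
  have hl : -1 < w * (3 + 4 * w) ^ 2 := by
    have : 0 < w + 1 / 4 := by linarith
    have h2 : w * (3 + 4 * w) ^ 2 + 1 = 16 * (w + 1 / 4) ^ 3 + 12 * (w + 1 / 4) ^ 2 := by ring
    have : 0 < w * (3 + 4 * w) ^ 2 + 1 := by rw [h2]; positivity
    linarith
  exact cubic_strictMonoOn.injOn (cubicInv_gt _) hw (cubicInv_eq hl)

theorem cubicInv_strictMonoOn : StrictMonoOn cubicInv (Set.Ioi (-1)) := by
  intro x hx y hy hxy
  by_contra! h
  have := cubic_strictMonoOn.monotoneOn (cubicInv_gt y) (cubicInv_gt x) h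
  simp only [cubicInv_eq hx, cubicInv_eq hy] at this
  linarith

theorem cubicInv_nonneg {l : ℝ} (hl : 0 ≤ l) : 0 ≤ cubicInv l := by
  have h0 : cubicInv 0 = 0 := by simpa using cubicInv_cubic (w := 0) (by norm_num)
  rw [← h0]
  exact cubicInv_strictMonoOn.monotoneOn (by simp) (show (-1 : ℝ) < l by linarith) hl

theorem cubicInv_continuousAt {l : ℝ} (hl : -1 < l) : ContinuousAt cubicInv l := by
  refine cubicInv_strictMonoOn.continuousAt_of_image_mem_nhds (Ioi_mem_nhds hl) ?_
  refine Filter.mem_of_superset (Ioi_mem_nhds (cubicInv_gt l)) ?_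
  intro w hw
  have hw' : -1 / 4 < w := hw
  refine ⟨w * (3 + 4 * w) ^ 2, ?_, cubicInv_cubic hw⟩
  have : 0 < w + 1 / 4 := by linarith
  have h2 : w * (3 + 4 * w) ^ 2 + 1 = 16 * (w + 1 / 4) ^ 3 + 12 * (w + 1 / 4) ^ 2 := by ring
  have : 0 < w * (3 + 4 * w) ^ 2 + 1 := by rw [h2]; positivity
  show (-1 : ℝ) < _
  linarith

theorem cubicInv_hasDerivAt {l : ℝ} (hl : -1 < l) :
    HasDerivAt cubicInv
      ((3 + 4 * cubicInv l)⁻¹ * (1 + 4 * cubicInv l)⁻¹ / 3) l := by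
  have hw := cubicInv_gt l
  have h3 : 3 + 4 * cubicInv l ≠ 0 := by linarith
  have h1 : 1 + 4 * cubicInv l ≠ 0 := by linarith
  have hd : HasDerivAt (fun w : ℝ => w * (3 + 4 * w) ^ 2)
      (3 * (3 + 4 * cubicInv l) * (1 + 4 * cubicInv l)) (cubicInv l) := by
    have hlin : HasDerivAt (fun w : ℝ => 3 + 4 * w) 4 (cubicInv l) := by
      simpa using ((hasDerivAt_id (cubicInv l)).const_mul 4).const_add 3
    refine ((hasDerivAt_id (cubicInv l)).mul (hlin.pow 2)).congr_deriv ?_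
    simp
    ring
  have := HasDerivAt.of_local_left_inverse (cubicInv_continuousAt hl) hd
    (mul_ne_zero (mul_ne_zero (by norm_num) h3) h1)
    (Filter.mem_of_superset (Ioi_mem_nhds hl) fun x hx => cubicInv_eq hx)
  refine this.congr_deriv ?_
  field_simp

/-- The reciprocal of `3 + 4w`, where `l = w(3+4w)²`. -/
def edgeP (l : ℝ) : ℝ := (3 + 4 * cubicInv l)⁻¹

/-- The reciprocal of `1 + 4w`, where `l = w(3+4w)²`. -/
def edgeQ (l : ℝ) : ℝ := (1 + 4 * cubicInv l)⁻¹

/-- The reciprocal of `√(1+w)`, where `l = w(3+4w)²`. -/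
def edgeR (l : ℝ) : ℝ := (Real.sqrt (1 + cubicInv l))⁻¹

theorem edgeP_hasDerivAt {l : ℝ} (hl : -1 < l) :
    HasDerivAt edgeP ((-4 / 3) * edgeP l ^ 3 * edgeQ l) l := by
  have hw := cubicInv_gt l
  have h3 : 3 + 4 * cubicInv l ≠ 0 := by linarith
  have := (((cubicInv_hasDerivAt hl).const_mul 4).const_add 3).inv h3
  refine this.congr_deriv ?_
  unfold edgeP edgeQ
  field_simp

theorem edgeQ_hasDerivAt {l : ℝ} (hl : -1 < l) :
    HasDerivAt edgeQ ((-4 / 3) * edgeP l * edgeQ l ^ 3) l := by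
  have hw := cubicInv_gt l
  have h3 : 1 + 4 * cubicInv l ≠ 0 := by linarith
  have := (((cubicInv_hasDerivAt hl).const_mul 4).const_add 1).inv h3
  refine this.congr_deriv ?_
  unfold edgeP edgeQ
  field_simp

theorem edgeR_hasDerivAt {l : ℝ} (hl : -1 < l) :
    HasDerivAt edgeR ((-1 / 6) * edgeP l * edgeQ l * edgeR l ^ 3) l := by
  have hw := cubicInv_gt l
  have h3 : 0 < 1 + cubicInv l := by linarith
  have hs : Real.sqrt (1 + cubicInv l) ≠ 0 := (Real.sqrt_pos.2 h3).ne'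
  have := (((cubicInv_hasDerivAt hl).const_add 1).sqrt h3.ne').inv hs
  refine this.congr_deriv ?_
  unfold edgeP edgeQ edgeR
  field_simp
  norm_num

/-- The algebra of real functions generated by `edgeP`, `edgeQ` and `edgeR`; it is closed under
differentiation and consists of functions bounded on `[0, ∞)`. -/
def edgeAlgebra : Subalgebra ℝ (ℝ → ℝ) := Algebra.adjoin ℝ {edgeP, edgeQ, edgeR}

theorem edgeP_mem : edgeP ∈ edgeAlgebra := Algebra.subset_adjoin (by simp)

theorem edgeQ_mem : edgeQ ∈ edgeAlgebra := Algebra.subset_adjoin (by simp)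

theorem edgeR_mem : edgeR ∈ edgeAlgebra := Algebra.subset_adjoin (by simp)

theorem edgeAlgebra_exists_deriv {f : ℝ → ℝ} (hf : f ∈ edgeAlgebra) :
    ∃ g ∈ edgeAlgebra, ∀ l, -1 < l → HasDerivAt f (g l) l := by
  induction hf using Algebra.adjoin_induction with
  | mem x hx =>
    simp only [Set.mem_insert_iff, Set.mem_singleton_iff] at hx
    rcases hx with rfl | rfl | rfl
    · refine ⟨(-4 / 3 : ℝ) • (edgeP ^ 3 * edgeQ), Subalgebra.smul_mem _
        (mul_mem (pow_mem edgeP_mem 3) edgeQ_mem) _, fun l hl => ?_⟩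
      refine (edgeP_hasDerivAt hl).congr_deriv ?_
      simp [mul_assoc]
    · refine ⟨(-4 / 3 : ℝ) • (edgeP * edgeQ ^ 3), Subalgebra.smul_mem _
        (mul_mem edgeP_mem (pow_mem edgeQ_mem 3)) _, fun l hl => ?_⟩
      refine (edgeQ_hasDerivAt hl).congr_deriv ?_
      simp [mul_assoc]
    · refine ⟨(-1 / 6 : ℝ) • (edgeP * edgeQ * edgeR ^ 3), Subalgebra.smul_mem _
        (mul_mem (mul_mem edgeP_mem edgeQ_mem) (pow_mem edgeR_mem 3)) _, fun l hl => ?_⟩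
      refine (edgeR_hasDerivAt hl).congr_deriv ?_
      simp [mul_assoc]
  | algebraMap r => exact ⟨0, zero_mem _, fun l _ => hasDerivAt_const l r⟩
  | add x y _ _ hx hy =>
    obtain ⟨g, hg, hg'⟩ := hx
    obtain ⟨k, hk, hk'⟩ := hy
    exact ⟨g + k, add_mem hg hk, fun l hl => (hg' l hl).add (hk' l hl)⟩
  | mul x y hx0 hy0 hx hy =>
    obtain ⟨g, hg, hg'⟩ := hx
    obtain ⟨k, hk, hk'⟩ := hy
    exact ⟨g * y + x * k, add_mem (mul_mem hg hy0) (mul_mem hx0 hk),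
      fun l hl => (hg' l hl).mul (hk' l hl)⟩

theorem edgeAlgebra_bounded {f : ℝ → ℝ} (hf : f ∈ edgeAlgebra) :
    ∃ D : ℝ, ∀ l, 0 ≤ l → |f l| ≤ D := by
  induction hf using Algebra.adjoin_induction with
  | mem x hx =>
    simp only [Set.mem_insert_iff, Set.mem_singleton_iff] at hx
    refine ⟨1, fun l hl => ?_⟩
    have hw := cubicInv_nonneg hl
    rcases hx with rfl | rfl | rfl
    · have h : 1 ≤ 3 + 4 * cubicInv l := by linarith
      rw [edgeP, abs_inv, abs_of_nonneg (by linarith)]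
      exact inv_le_one_of_one_le₀ h
    · have h : 1 ≤ 1 + 4 * cubicInv l := by linarith
      rw [edgeQ, abs_inv, abs_of_nonneg (by linarith)]
      exact inv_le_one_of_one_le₀ h
    · have h : 1 ≤ Real.sqrt (1 + cubicInv l) := Real.one_le_sqrt.2 (by linarith)
      rw [edgeR, abs_inv, abs_of_nonneg (by linarith)]
      exact inv_le_one_of_one_le₀ h
  | algebraMap r => exact ⟨|r|, fun l _ => le_rfl⟩
  | add x y _ _ hx hy =>
    obtain ⟨D, hD⟩ := hx
    obtain ⟨E, hE⟩ := hy
    exact ⟨D + E, fun l hl => (abs_add_le _ _).trans (add_le_add (hD l hl) (hE l hl))⟩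
  | mul x y _ _ hx hy =>
    obtain ⟨D, hD⟩ := hx
    obtain ⟨E, hE⟩ := hy
    refine ⟨D * E, fun l hl => ?_⟩
    rw [Pi.mul_apply, abs_mul]
    exact mul_le_mul (hD l hl) (hE l hl) (abs_nonneg _) ((abs_nonneg _).trans (hD l hl))

theorem edgeAlgebra_contDiffOn {f : ℝ → ℝ} (hf : f ∈ edgeAlgebra) :
    ContDiffOn ℝ (⊤ : ℕ∞) f (Set.Ioi (-1)) := by
  rw [contDiffOn_infty]
  intro n
  induction n generalizing f with
  | zero =>
    obtain ⟨g, -, hg⟩ := edgeAlgebra_exists_deriv hf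
    exact contDiffOn_zero.2 fun l hl => (hg l hl).continuousAt.continuousWithinAt
  | succ n ih =>
    obtain ⟨g, hgA, hg⟩ := edgeAlgebra_exists_deriv hf
    rw [Nat.cast_add, Nat.cast_one, contDiffOn_succ_iff_deriv_of_isOpen isOpen_Ioi]
    refine ⟨fun l hl => (hg l hl).differentiableAt.differentiableWithinAt, by simp, ?_⟩
    exact (ih hgA).congr fun l hl => (hg l hl).deriv

/-- A smooth map `ℝ → (-1, ∞)` that is the identity on `[-1/4, ∞)`. -/
def edgeCut (l : ℝ) : ℝ := Real.smoothTransition (4 * l + 2) * l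

theorem edgeCut_contDiff : ContDiff ℝ (⊤ : ℕ∞) edgeCut :=
  (Real.smoothTransition.contDiff.comp (by fun_prop)).mul contDiff_id

theorem edgeCut_gt (l : ℝ) : -1 < edgeCut l := by
  unfold edgeCut
  rcases le_total (4 * l + 2) 0 with h | h
  · rw [Real.smoothTransition.zero_of_nonpos h]; norm_num
  · have h0 := Real.smoothTransition.nonneg (4 * l + 2)
    have h1 := Real.smoothTransition.le_one (4 * l + 2)
    nlinarith

theorem edgeCut_eq {l : ℝ} (hl : -1 / 4 ≤ l) : edgeCut l = l := by
  unfold edgeCut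
  rw [Real.smoothTransition.one_of_one_le (by linarith), one_mul]

/-- The correction factor of `psiEdge`, before extension to the whole line. -/
def edgeCore : ℝ → ℝ := (3 / 4 : ℝ) • (edgeR * (1 + edgeP)) - 1

theorem edgeCore_mem : edgeCore ∈ edgeAlgebra :=
  sub_mem (Subalgebra.smul_mem _ (mul_mem edgeR_mem (add_mem (one_mem _) edgeP_mem)) _)
    (one_mem _)

/-- The correction factor `Ψ̃` of `psiEdge`. -/
def edgeTilde (l : ℝ) : ℝ := edgeCore (edgeCut l)

theorem edgeTilde_contDiff : ContDiff ℝ (⊤ : ℕ∞) edgeTilde :=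
  contDiffOn_univ.1 ((edgeAlgebra_contDiffOn edgeCore_mem).comp edgeCut_contDiff.contDiffOn
    fun l _ => edgeCut_gt l)

theorem edgeTilde_iteratedDeriv (n : ℕ) :
    ∃ f ∈ edgeAlgebra, ∀ l, -1 / 4 < l → iteratedDeriv n edgeTilde l = f l := by
  induction n with
  | zero =>
    refine ⟨edgeCore, edgeCore_mem, fun l hl => ?_⟩
    rw [iteratedDeriv_zero, edgeTilde, edgeCut_eq hl.le]
  | succ n ih =>
    obtain ⟨f, hf, hfe⟩ := ih
    obtain ⟨g, hg, hge⟩ := edgeAlgebra_exists_deriv hf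
    refine ⟨g, hg, fun l hl => ?_⟩
    have he : iteratedDeriv n edgeTilde =ᶠ[nhds l] f :=
      Filter.mem_of_superset (Ioi_mem_nhds hl) fun x hx => hfe x hx
    rw [iteratedDeriv_succ, he.deriv_eq]
    exact (hge l (by linarith)).deriv

theorem edgeTilde_iteratedDeriv_bounded (n : ℕ) :
    ∃ D : ℝ, ∀ l : ℝ, 0 ≤ l → |iteratedDeriv n edgeTilde l| ≤ D := by
  obtain ⟨f, hf, hfe⟩ := edgeTilde_iteratedDeriv n
  obtain ⟨D, hD⟩ := edgeAlgebra_bounded hf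
  exact ⟨D, fun l hl => by rw [hfe l (by linarith)]; exact hD l hl⟩

theorem one_add_edgeTilde {l : ℝ} (hl : 0 ≤ l) :
    1 + edgeTilde l = 3 * Real.sqrt (1 + cubicInv l) / (3 + 4 * cubicInv l) := by
  have hw := cubicInv_nonneg hl
  have hs : 0 < Real.sqrt (1 + cubicInv l) := Real.sqrt_pos.2 (by linarith)
  have hsq := Real.sq_sqrt (show 0 ≤ 1 + cubicInv l by linarith)
  rw [edgeTilde, edgeCut_eq (by linarith)]
  simp only [edgeCore, edgeR, edgeP, Pi.sub_apply, Pi.smul_apply, Pi.mul_apply, Pi.add_apply,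
    Pi.one_apply, smul_eq_mul]
  field_simp
  rw [hsq]
  ring

theorem rpow_third_of_cube {x : ℝ} (hx : 0 ≤ x) : (x ^ 3) ^ ((1 : ℝ) / 3) = x := by
  rw [← Real.rpow_natCast, ← Real.rpow_mul hx]
  norm_num

theorem rpow_two_thirds_of_cube {x : ℝ} (hx : 0 ≤ x) : (x ^ 3) ^ ((2 : ℝ) / 3) = x ^ 2 := by
  rw [← Real.rpow_natCast, ← Real.rpow_mul hx, ← Real.rpow_natCast]
  norm_num

section Parametrization

variable {w : ℝ}

theorem sqrt_edge_parametrization (hw : 0 ≤ w) :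
    Real.sqrt ((1 + w * (3 + 4 * w) ^ 2) * (w * (3 + 4 * w) ^ 2))
      = Real.sqrt (w * (1 + w)) * ((3 + 4 * w) * (1 + 4 * w)) := by
  rw [show (1 + w * (3 + 4 * w) ^ 2) * (w * (3 + 4 * w) ^ 2)
    = (w * (1 + w)) * ((3 + 4 * w) * (1 + 4 * w)) ^ 2 by ring,
    Real.sqrt_mul (by positivity), Real.sqrt_sq (by positivity)]

theorem edge_cube_add (hw : 0 ≤ w) :
    1 + 2 * (w * (3 + 4 * w) ^ 2) + 2 * (Real.sqrt (w * (1 + w)) * ((3 + 4 * w) * (1 + 4 * w)))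
      = (1 + 2 * w + 2 * Real.sqrt (w * (1 + w))) ^ 3 := by
  have hsq := Real.sq_sqrt (show 0 ≤ w * (1 + w) by positivity)
  linear_combination (-12 * (1 + 2 * w) - 8 * Real.sqrt (w * (1 + w))) * hsq

theorem edge_cube_sub (hw : 0 ≤ w) :
    1 + 2 * (w * (3 + 4 * w) ^ 2) - 2 * (Real.sqrt (w * (1 + w)) * ((3 + 4 * w) * (1 + 4 * w)))
      = (1 + 2 * w - 2 * Real.sqrt (w * (1 + w))) ^ 3 := by
  have hsq := Real.sq_sqrt (show 0 ≤ w * (1 + w) by positivity)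
  linear_combination (-12 * (1 + 2 * w) + 8 * Real.sqrt (w * (1 + w))) * hsq

theorem edge_root_sub_nonneg (hw : 0 ≤ w) : 0 ≤ 1 + 2 * w - 2 * Real.sqrt (w * (1 + w)) := by
  have : Real.sqrt (w * (1 + w)) ≤ w + 1 / 2 := Real.sqrt_le_iff.2 ⟨by linarith, by nlinarith⟩
  linarith

theorem psiEdge_cubic (hw : 0 ≤ w) :
    psiEdge (w * (3 + 4 * w) ^ 2) = Real.sqrt (w * (1 + w)) := by
  have hsq := Real.sq_sqrt (show 0 ≤ w * (1 + w) by positivity)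
  rw [psiEdge, sqrt_edge_parametrization hw, edge_cube_add hw, edge_cube_sub hw,
    rpow_two_thirds_of_cube (by positivity), rpow_two_thirds_of_cube (edge_root_sub_nonneg hw),
    show (1 + 2 * w + 2 * Real.sqrt (w * (1 + w))) ^ 2
      + (1 + 2 * w - 2 * Real.sqrt (w * (1 + w))) ^ 2 + 1 = (3 + 4 * w) * (1 + 4 * w) by
        linear_combination 8 * hsq]
  exact mul_div_cancel_right₀ _ (by positivity)

end Parametrization

theorem psiEdge_eq_sqrt {l : ℝ} (hl : 0 ≤ l) :
    psiEdge l = Real.sqrt (cubicInv l * (1 + cubicInv l)) := by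
  conv_lhs => rw [← cubicInv_eq (show -1 < l by linarith)]
  exact psiEdge_cubic (cubicInv_nonneg hl)

theorem psiEdge_eq_edgeTilde {l : ℝ} (hl : 0 ≤ l) :
    psiEdge l = Real.sqrt l / 3 * (1 + edgeTilde l) := by
  have hw := cubicInv_nonneg hl
  have hs : Real.sqrt l = Real.sqrt (cubicInv l) * (3 + 4 * cubicInv l) := by
    conv_lhs => rw [← cubicInv_eq (show -1 < l by linarith)]
    rw [Real.sqrt_mul hw, Real.sqrt_sq (by linarith)]
  rw [psiEdge_eq_sqrt hl, one_add_edgeTilde hl, hs, Real.sqrt_mul hw]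
  field_simp

theorem nine_mul_cubicInv_le {l : ℝ} (hl : 0 ≤ l) : 9 * cubicInv l ≤ l := by
  have hw := cubicInv_nonneg hl
  have := cubicInv_eq (show -1 < l by linarith)
  nlinarith [pow_nonneg hw 2, pow_nonneg hw 3]

theorem abs_edgeTilde_le {l : ℝ} (hl : 0 ≤ l) : |edgeTilde l| ≤ l ∧ |edgeTilde l| ≤ 1 := by
  have hw := cubicInv_nonneg hl
  have h9 := nine_mul_cubicInv_le hl
  have he := one_add_edgeTilde hl
  have hs1 : 1 ≤ Real.sqrt (1 + cubicInv l) := Real.one_le_sqrt.2 (by linarith)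
  have hs2 : Real.sqrt (1 + cubicInv l) ≤ 1 + cubicInv l :=
    Real.sqrt_le_iff.2 ⟨by linarith, by nlinarith⟩
  have hd : 0 < 3 + 4 * cubicInv l := by linarith
  have hup : 1 + edgeTilde l ≤ 1 := by
    rw [he, div_le_one hd]; linarith
  have hpos : 0 ≤ 1 + edgeTilde l := by rw [he]; positivity
  have hlow : 1 - l ≤ 1 + edgeTilde l := by
    rw [he, le_div_iff₀ hd]
    nlinarith [mul_nonneg hl hw]
  constructor <;> rw [abs_of_nonpos (by linarith)] <;> linarith

theorem psiMin_eq (l : ℝ) :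
    psiMin l = ((Real.sqrt (1 + l ^ 2) + l) ^ ((1 : ℝ) / 3)
      + (Real.sqrt (1 + l ^ 2) - l) ^ ((1 : ℝ) / 3)) / 2 - 1 := by
  have hsq := Real.sq_sqrt (show 0 ≤ 1 + l ^ 2 by positivity)
  have habs : |l| < Real.sqrt (1 + l ^ 2) := Real.lt_sqrt (abs_nonneg l) |>.2 (by simp)
  obtain ⟨h1, h2⟩ := abs_lt.1 habs
  have hp : 0 < Real.sqrt (1 + l ^ 2) + l := by linarith
  have hm : 0 < Real.sqrt (1 + l ^ 2) - l := by linarith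
  have cube : ∀ x : ℝ, 0 < x → (x ^ ((1 : ℝ) / 3)) ^ 3 = x := fun x hx => by
    rw [← Real.rpow_natCast, ← Real.rpow_mul hx.le]; norm_num
  have square : ∀ x : ℝ, 0 < x → x ^ ((2 : ℝ) / 3) = (x ^ ((1 : ℝ) / 3)) ^ 2 := fun x hx => by
    rw [← Real.rpow_natCast, ← Real.rpow_mul hx.le]; norm_num
  have hab : (Real.sqrt (1 + l ^ 2) + l) ^ ((1 : ℝ) / 3)
      * (Real.sqrt (1 + l ^ 2) - l) ^ ((1 : ℝ) / 3) = 1 := by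
    rw [← Real.mul_rpow hp.le hm.le, show (Real.sqrt (1 + l ^ 2) + l) * (Real.sqrt (1 + l ^ 2) - l)
      = 1 by linear_combination hsq, Real.one_rpow]
  have ha3 := cube _ hp
  have hb3 := cube _ hm
  rw [psiMin, square _ hp, square _ hm]
  have ha := Real.rpow_pos_of_pos hp ((1 : ℝ) / 3)
  have hb := Real.rpow_pos_of_pos hm ((1 : ℝ) / 3)
  generalize (Real.sqrt (1 + l ^ 2) + l) ^ ((1 : ℝ) / 3) = a at *
  generalize (Real.sqrt (1 + l ^ 2) - l) ^ ((1 : ℝ) / 3) = b at *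
  have hd : a ^ 2 + b ^ 2 - 1 ≠ 0 := by nlinarith [sq_nonneg (a - b)]
  rw [sub_left_inj, div_eq_iff hd]
  linear_combination (-1 / 2) * ha3 + (-1 / 2) * hb3 - (a + b) / 2 * hab

theorem PhiFn_ofReal (l : ℝ) :
    PhiFn (l : ℂ) = (((Real.sqrt (1 + l ^ 2) + l) ^ ((1 : ℝ) / 3) : ℝ) : ℂ) := by
  have hle : |l| ≤ Real.sqrt (1 + l ^ 2) := Real.abs_le_sqrt (by simp)
  have := (abs_le.1 hle).1
  have h0 : 0 ≤ 1 + l ^ 2 := by positivity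
  rw [PhiFn, Complex.ofReal_cpow (by linarith), Complex.ofReal_add, Real.sqrt_eq_rpow,
    Complex.ofReal_cpow h0]
  push_cast
  rfl

theorem OmHatMin_ofReal_im (l : ℝ) :
    (OmHatMin (l : ℂ)).im = Real.sqrt 3 * (((Real.sqrt (1 + l ^ 2) + l) ^ ((1 : ℝ) / 3)
      + (Real.sqrt (1 + l ^ 2) - l) ^ ((1 : ℝ) / 3)) / 2) := by
  have hneg : PhiFn (-(l : ℂ)) = (((Real.sqrt (1 + l ^ 2) - l) ^ ((1 : ℝ) / 3) : ℝ) : ℂ) := by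
    have := PhiFn_ofReal (-l)
    rwa [Complex.ofReal_neg, neg_sq, ← sub_eq_add_neg] at this
  rw [OmHatMin, PhiOdd, PhiEven, PhiFn_ofReal, hneg, ← Complex.ofReal_sub, ← Complex.ofReal_add]
  simp only [mul_assoc, ← Complex.ofReal_ofNat, ← Complex.ofReal_div, ← Complex.ofReal_mul,
    Complex.add_im, Complex.ofReal_im, Complex.I_mul_im, Complex.ofReal_re, zero_add]

theorem psiMin_eq_im (l : ℝ) :
    psiMin l = (Real.sqrt 3)⁻¹ * (OmHatMin (l : ℂ) - OmHatMin 0).im := by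
  have h0 := OmHatMin_ofReal_im 0
  rw [Complex.ofReal_zero] at h0
  have h3 : Real.sqrt 3 ≠ 0 := by positivity
  rw [psiMin_eq, Complex.sub_im, OmHatMin_ofReal_im, h0]
  norm_num
  field_simp

theorem psiEdge_eq_im {l : ℝ} (hl : 0 ≤ l) :
    psiEdge l = (2 * Real.sqrt 3)⁻¹ * (OmHatP ((1 + 2 * l : ℝ) : ℂ)).im := by
  have hw := cubicInv_nonneg hl
  have heq := cubicInv_eq (show -1 < l by linarith)
  have hroot : ((((1 + 2 * l : ℝ) : ℂ)) ^ 2 - 1) ^ ((1 : ℂ) / 2)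
      = ((2 * Real.sqrt ((1 + l) * l) : ℝ) : ℂ) := by
    have h : 2 * Real.sqrt ((1 + l) * l) = ((1 + 2 * l) ^ 2 - 1) ^ ((1 : ℝ) / 2) := by
      rw [← Real.sqrt_eq_rpow, show (1 + 2 * l) ^ 2 - 1 = 2 ^ 2 * ((1 + l) * l) by ring,
        Real.sqrt_mul (show (0 : ℝ) ≤ 2 ^ 2 by norm_num), Real.sqrt_sq zero_le_two]
    rw [h, Complex.ofReal_cpow (by nlinarith)]
    push_cast
    rfl
  have hs := sqrt_edge_parametrization hw
  have hA := edge_cube_add hw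
  have hB := edge_cube_sub hw
  rw [← hs, heq] at hA hB
  have hP : PhiP ((1 + 2 * l : ℝ) : ℂ)
      = ((1 + 2 * cubicInv l + 2 * Real.sqrt (cubicInv l * (1 + cubicInv l)) : ℝ) : ℂ) := by
    rw [PhiP, if_pos (by rw [Complex.ofReal_re]; linarith), hroot, ← Complex.ofReal_add, hA,
      ← rpow_third_of_cube (show 0 ≤ 1 + 2 * cubicInv l
        + 2 * Real.sqrt (cubicInv l * (1 + cubicInv l)) by positivity),
      Complex.ofReal_cpow (by positivity), rpow_third_of_cube (by positivity)]
    push_cast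
    rfl
  have hM : PhiM ((1 + 2 * l : ℝ) : ℂ)
      = ((1 + 2 * cubicInv l - 2 * Real.sqrt (cubicInv l * (1 + cubicInv l)) : ℝ) : ℂ) := by
    have h0 := edge_root_sub_nonneg hw
    rw [PhiM, if_pos (by rw [Complex.ofReal_re]; linarith), hroot, ← Complex.ofReal_sub, hB,
      ← rpow_third_of_cube h0, Complex.ofReal_cpow (by positivity), rpow_third_of_cube h0]
    push_cast
    rfl
  have h3 : Real.sqrt 3 ≠ 0 := by positivity
  have him : (OmHatP ((1 + 2 * l : ℝ) : ℂ)).im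
      = Real.sqrt 3 / 2 * (4 * Real.sqrt (cubicInv l * (1 + cubicInv l))) := by
    rw [OmHatP, hP, hM, ← Complex.ofReal_add, ← Complex.ofReal_sub]
    simp only [mul_assoc, mul_div_assoc, ← Complex.ofReal_ofNat, ← Complex.ofReal_div,
      ← Complex.ofReal_mul, Complex.add_im, Complex.ofReal_im, Complex.I_mul_im,
      Complex.ofReal_re, zero_add]
    ring
  rw [psiEdge_eq_sqrt hl, him]
  field_simp
  norm_num

theorem exists_abs_edgeTilde_sub_le :
    ∃ D : ℝ, 0 ≤ D ∧ ∀ x y : ℝ, 0 ≤ x → 0 ≤ y → |edgeTilde y - edgeTilde x| ≤ D * |y - x| := by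
  obtain ⟨D, hD⟩ := edgeTilde_iteratedDeriv_bounded 1
  refine ⟨D, (abs_nonneg _).trans (hD 0 le_rfl), fun x y hx hy => ?_⟩
  refine (convex_Ici (0 : ℝ)).norm_image_sub_le_of_norm_deriv_le
    (fun z _ => (edgeTilde_contDiff.differentiable (by simp)).differentiableAt)
    (fun z hz => ?_) hx hy
  simpa [iteratedDeriv_one] using hD z hz

theorem abs_cubicInv_sub_le {ε l : ℝ} (hε : |ε| ≤ 1 / 2) (hl : 0 < l) :
    |cubicInv ((1 + ε) * l) - cubicInv l| ≤ |ε| * cubicInv l := by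
  obtain ⟨hε1, hε2⟩ := abs_le.1 hε
  have hl' : 0 ≤ (1 + ε) * l := mul_nonneg (by linarith) hl.le
  have hx := cubicInv_eq (show -1 < l by linarith)
  have hy := cubicInv_eq (show -1 < (1 + ε) * l by linarith)
  have hx0 := cubicInv_nonneg hl.le
  have hy0 := cubicInv_nonneg hl'
  generalize cubicInv ((1 + ε) * l) = y at *
  generalize cubicInv l = x at *
  have key : (y - x) * (16 * y ^ 2 + 16 * (x * y) + 24 * y + (3 + 4 * x) ^ 2)
      = ε * (x * (3 + 4 * x) ^ 2) := by linear_combination hy - hx - ε * hx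
  have habs := congrArg abs key
  rw [abs_mul, abs_mul, abs_of_nonneg (show 0 ≤ x * (3 + 4 * x) ^ 2 by positivity),
    abs_of_nonneg (show 0 ≤ 16 * y ^ 2 + 16 * (x * y) + 24 * y + (3 + 4 * x) ^ 2 by positivity)]
    at habs
  have hpos : 0 < (3 + 4 * x) ^ 2 := by positivity
  refine le_of_mul_le_mul_right ?_ hpos
  have : 0 ≤ |y - x| * (16 * y ^ 2 + 16 * (x * y) + 24 * y) := by positivity
  linarith

theorem abs_psiEdge_sub_le {ε l : ℝ} (hε : |ε| ≤ 1 / 2) (hl : 1 ≤ l) :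
    |psiEdge ((1 + ε) * l) - psiEdge l| ≤ 21 * |ε| * cubicInv l := by
  obtain ⟨hε1, hε2⟩ := abs_le.1 hε
  have hl0 : 0 ≤ l := by linarith
  have hl' : 0 ≤ (1 + ε) * l := mul_nonneg (by linarith) hl0
  have hdiff := abs_cubicInv_sub_le hε (by linarith : 0 < l)
  rw [psiEdge_eq_sqrt hl', psiEdge_eq_sqrt hl0]
  have hx := cubicInv_eq (show -1 < l by linarith)
  have hx0 := cubicInv_nonneg hl0
  have hy0 := cubicInv_nonneg hl'
  generalize cubicInv ((1 + ε) * l) = y at *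
  generalize cubicInv l = x at *
  have hx1 : 1 ≤ 20 * x := by
    by_contra! h
    nlinarith [pow_nonneg hx0 2, mul_nonneg hx0 (sub_nonneg.2 h.le)]
  have hle : ∀ z : ℝ, 0 ≤ z → z ≤ Real.sqrt (z * (1 + z)) := fun z hz =>
    Real.le_sqrt_of_sq_le (by nlinarith)
  have hlx := hle x hx0
  have hly := hle y hy0
  have hsx := Real.sq_sqrt (show 0 ≤ x * (1 + x) by positivity)
  have hsy := Real.sq_sqrt (show 0 ≤ y * (1 + y) by positivity)
  generalize Real.sqrt (x * (1 + x)) = X at *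
  generalize Real.sqrt (y * (1 + y)) = Y at *
  have hpos : 0 < Y + X := by linarith
  have habs := congrArg abs (show (Y - X) * (Y + X) = (y - x) * (1 + x + y) by
    linear_combination hsy - hsx)
  rw [abs_mul, abs_mul, abs_of_pos hpos, abs_of_nonneg (show 0 ≤ 1 + x + y by linarith)] at habs
  refine le_of_mul_le_mul_right ?_ hpos
  rw [habs]
  calc |y - x| * (1 + x + y) ≤ (|ε| * x) * (21 * (Y + X)) :=
        mul_le_mul hdiff (by linarith) (by linarith) (by positivity)
    _ = 21 * |ε| * x * (Y + X) := by ring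

theorem cubicInv_le_rpow {l : ℝ} (hl : 0 ≤ l) : cubicInv l ≤ l ^ ((1 : ℝ) / 3) := by
  have hw := cubicInv_nonneg hl
  have heq := cubicInv_eq (show -1 < l by linarith)
  rw [← rpow_third_of_cube hw]
  refine Real.rpow_le_rpow (by positivity) ?_ (by norm_num)
  nlinarith [pow_nonneg hw 2, pow_nonneg hw 3]

theorem abs_sqrt_one_add_sub_one_le {ε : ℝ} (hε : |ε| ≤ 1 / 2) :
    |Real.sqrt (1 + ε) - 1| ≤ |ε| := by
  obtain ⟨hε1, hε2⟩ := abs_le.1 hε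
  have hs := Real.sqrt_nonneg (1 + ε)
  have hsq := Real.sq_sqrt (show 0 ≤ 1 + ε by linarith)
  have habs := congrArg abs (show (Real.sqrt (1 + ε) - 1) * (Real.sqrt (1 + ε) + 1) = ε by
    linear_combination hsq)
  rw [abs_mul, abs_of_nonneg (show 0 ≤ Real.sqrt (1 + ε) + 1 by linarith)] at habs
  nlinarith [abs_nonneg (Real.sqrt (1 + ε) - 1)]

theorem abs_psiEdge_scaling_le_of_one_le {ε l : ℝ} (hε : |ε| ≤ 1 / 2) (hl : 1 ≤ l) :
    |psiEdge ((1 + ε) * l) - Real.sqrt (1 + ε) * psiEdge l| ≤ 23 * |ε| * l ^ ((1 : ℝ) / 3) := by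
  have hl0 : 0 ≤ l := by linarith
  have h1 := abs_psiEdge_sub_le hε hl
  have h2 := abs_sqrt_one_add_sub_one_le hε
  have hw := cubicInv_le_rpow hl0
  have hw0 := cubicInv_nonneg hl0
  have hone : 1 ≤ l ^ ((1 : ℝ) / 3) := Real.one_le_rpow hl (by norm_num)
  have hpsi : |psiEdge l| ≤ 2 * l ^ ((1 : ℝ) / 3) := by
    rw [psiEdge_eq_sqrt hl0, abs_of_nonneg (Real.sqrt_nonneg _)]
    have : Real.sqrt (cubicInv l * (1 + cubicInv l)) ≤ 1 + cubicInv l :=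
      Real.sqrt_le_iff.2 ⟨by linarith, by nlinarith⟩
    linarith
  calc |psiEdge ((1 + ε) * l) - Real.sqrt (1 + ε) * psiEdge l|
      = |(psiEdge ((1 + ε) * l) - psiEdge l) - (Real.sqrt (1 + ε) - 1) * psiEdge l| := by
        congr 1; ring
    _ ≤ |psiEdge ((1 + ε) * l) - psiEdge l| + |(Real.sqrt (1 + ε) - 1) * psiEdge l| :=
        abs_sub _ _
    _ ≤ 21 * |ε| * l ^ ((1 : ℝ) / 3) + |ε| * (2 * l ^ ((1 : ℝ) / 3)) := by
        rw [abs_mul]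
        gcongr
        exact h1.trans (by gcongr)
    _ = 23 * |ε| * l ^ ((1 : ℝ) / 3) := by ring

theorem exists_abs_psiEdge_scaling_le :
    ∃ D : ℝ, 0 ≤ D ∧ ∀ ε l : ℝ, |ε| ≤ 1 / 2 → 0 ≤ l →
      |psiEdge ((1 + ε) * l) - Real.sqrt (1 + ε) * psiEdge l| ≤ D * |ε| * l ^ ((3 : ℝ) / 2) := by
  obtain ⟨D, hD0, hD⟩ := exists_abs_edgeTilde_sub_le
  refine ⟨D, hD0, fun ε l hε hl => ?_⟩
  obtain ⟨hε1, hε2⟩ := abs_le.1 hε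
  have hl' : 0 ≤ (1 + ε) * l := mul_nonneg (by linarith) hl
  have hs : Real.sqrt (1 + ε) ≤ 3 := Real.sqrt_le_iff.2 ⟨by norm_num, by linarith⟩
  have hrp : l ^ ((3 : ℝ) / 2) = Real.sqrt l * l := by
    rw [show (3 : ℝ) / 2 = 1 / 2 + 1 by norm_num, Real.rpow_add_one' hl (by norm_num),
      Real.sqrt_eq_rpow]
  have hT := hD l ((1 + ε) * l) hl hl'
  rw [show (1 + ε) * l - l = ε * l by ring, abs_mul, abs_of_nonneg hl] at hT
  rw [psiEdge_eq_edgeTilde hl, psiEdge_eq_edgeTilde hl', Real.sqrt_mul (by linarith), hrp,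
    show Real.sqrt (1 + ε) * Real.sqrt l / 3 * (1 + edgeTilde ((1 + ε) * l))
      - Real.sqrt (1 + ε) * (Real.sqrt l / 3 * (1 + edgeTilde l))
      = Real.sqrt (1 + ε) / 3 * Real.sqrt l * (edgeTilde ((1 + ε) * l) - edgeTilde l) by ring,
    abs_mul, abs_of_nonneg (by positivity)]
  calc Real.sqrt (1 + ε) / 3 * Real.sqrt l * |edgeTilde ((1 + ε) * l) - edgeTilde l|
      ≤ 1 * Real.sqrt l * (D * (|ε| * l)) := by
        gcongr
        linarith
    _ = D * |ε| * (Real.sqrt l * l) := by ring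

/-- **Lemma (properties of `Ψ_min` and `Ψ_edge`).**
(i) `Ψ_min(λ) = (1/√3)·Im(Ω̂(λ) − Ω̂(0))`; (ii) `Ψ_edge(λ) = (1/(2√3))·Im Ω̂₊(1+2λ)` for
`λ ≥ 0`; (iii) `Ψ_edge(λ) = (λ^{1/2}/3)(1 + Ψ̃(λ))` with a smooth `Ψ̃`, `Ψ̃(0) = 0`,
having uniformly bounded derivatives and `|Ψ̃(λ)| ≤ C·min{λ, λ^{1/3}}`; (iv) the rescaling
identity `Ψ_edge((1+ε)λ) = (1+ε)^{1/2}Ψ_edge(λ) + O(ε·min{λ^{3/2}, λ^{1/3}})`. -/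
theorem psi_min_psi_edge_properties :
    (∀ l : ℝ, psiMin l = (Real.sqrt 3)⁻¹ * (OmHatMin (l : ℂ) - OmHatMin 0).im) ∧
    (∀ l : ℝ, 0 ≤ l →
      psiEdge l = (2 * Real.sqrt 3)⁻¹ * (OmHatP ((1 + 2 * l : ℝ) : ℂ)).im) ∧
    (∃ Pt : ℝ → ℝ, ContDiff ℝ (⊤ : ℕ∞) Pt ∧ Pt 0 = 0 ∧
      (∀ n : ℕ, ∃ D : ℝ, ∀ l : ℝ, 0 ≤ l → |iteratedDeriv n Pt l| ≤ D) ∧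
      ∃ C : ℝ, 0 < C ∧
        (∀ l : ℝ, 0 ≤ l → psiEdge l = Real.sqrt l / 3 * (1 + Pt l)) ∧
        (∀ l : ℝ, 0 ≤ l → |Pt l| ≤ C * min l (l ^ ((1 : ℝ)/3)))) ∧
    (∃ εstar C : ℝ, 0 < εstar ∧ 0 < C ∧
      ∀ ε l : ℝ, |ε| ≤ εstar → 0 ≤ l →
        |psiEdge ((1 + ε) * l) - Real.sqrt (1 + ε) * psiEdge l|
          ≤ C * |ε| * min (l ^ ((3 : ℝ)/2)) (l ^ ((1 : ℝ)/3))) := by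
  refine ⟨psiMin_eq_im, fun l hl => psiEdge_eq_im hl, ?_, ?_⟩
  · refine ⟨edgeTilde, edgeTilde_contDiff, ?_, edgeTilde_iteratedDeriv_bounded, 1, one_pos,
      fun l hl => psiEdge_eq_edgeTilde hl, fun l hl => ?_⟩
    · simpa using (abs_edgeTilde_le le_rfl).1
    · obtain ⟨h1, h2⟩ := abs_edgeTilde_le hl
      rw [one_mul]
      refine le_min h1 ?_
      rcases le_total l 1 with h | h
      · exact h1.trans (Real.self_le_rpow_of_le_one hl h (by norm_num))
      · exact h2.trans (Real.one_le_rpow h (by norm_num))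
  · obtain ⟨D, hD0, hD⟩ := exists_abs_psiEdge_scaling_le
    refine ⟨1 / 2, D + 23, by norm_num, by linarith, fun ε l hε hl => ?_⟩
    have hmin : 0 ≤ min (l ^ ((3 : ℝ) / 2)) (l ^ ((1 : ℝ) / 3)) := by positivity
    rcases le_total l 1 with h | h
    · have : min (l ^ ((3 : ℝ) / 2)) (l ^ ((1 : ℝ) / 3)) = l ^ ((3 : ℝ) / 2) :=
        min_eq_left (Real.rpow_le_rpow_of_exponent_ge' hl h (by norm_num) (by norm_num))
      rw [this] at hmin ⊢
      refine (hD ε l hε hl).trans ?_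
      gcongr
      linarith
    · have : min (l ^ ((3 : ℝ) / 2)) (l ^ ((1 : ℝ) / 3)) = l ^ ((1 : ℝ) / 3) :=
        min_eq_right (Real.rpow_le_rpow_of_exponent_le h (by norm_num))
      rw [this] at hmin ⊢
      refine (abs_psiEdge_scaling_le_of_one_le hε h).trans ?_
      gcongr
      linarith
end
end
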